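/- arXiv:2508.17438 — 2 statements merged into one kernel-verified Lean document; each statement's English description precedes it below -/
import Mathlib

section
/- There exists a constant c > 0 such that for all integers n > d ≥ 2, in every connected d-regular vertex-transitive graph G on n vertices, any two longest cycles X and Y of G satisfy |V(X) ∩ V(Y)| ≥ c·(log n / log d)^(1/3). -/
open SimpleGraph

/-- `X` is a longest cycle in `G`. -/
def IsLongestCycle {V : Type*} (G : SimpleGraph V) {x : V} (X : G.Walk x x) : Prop :=
  X.IsCycle ∧ ∀ (y : V) (W : G.Walk y y), W.IsCycle → W.length ≤ X.length

/-- `G` is vertex-transitive: any vertex can be mapped to any other by an automorphism. -/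
def IsVertexTransitive {V : Type*} (G : SimpleGraph V) : Prop :=
  ∀ u v : V, ∃ g : G ≃g G, g u = v

section Menger

variable {V : Type}

lemma mgr_first {G : SimpleGraph V} (S : Finset V) (x y : V) (hy : y ∉ S)
    {a b : V} (p : G.Walk a b) (hit : ∃ v ∈ p.support, v ∈ S ∨ v = x) :
    ∃ c, ∃ q : (G.deleteEdges {s(x,y)}).Walk a c, (∀ v ∈ q.support, v ∈ p.support) ∧
      ((c ∈ S ∨ c = x) ∨ (c = y ∧ ∀ v ∈ q.support, v ∉ S)) := by
  induction p with
  | nil =>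
    rename_i u
    refine ⟨u, Walk.nil, by simp, Or.inl ?_⟩
    simpa using hit
  | cons h p ih =>
    rename_i u w z
    by_cases h1 : u ∈ S ∨ u = x
    · exact ⟨u, Walk.nil, by simp, Or.inl h1⟩
    by_cases h2 : u = y
    · exact ⟨u, Walk.nil, by simp, Or.inr ⟨h2, by simpa [h2] using hy⟩⟩
    push Not at h1
    obtain ⟨c, q, hq, hc⟩ := ih (by
      obtain ⟨v, hv, hv'⟩ := hit
      rw [Walk.support_cons, List.mem_cons] at hv
      rcases hv with rfl | hv
      · exact absurd hv' (by tauto)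
      · exact ⟨v, hv, hv'⟩)
    refine ⟨c, Walk.cons (v := w) ?_ q, ?_, ?_⟩
    · rw [deleteEdges_adj]
      refine ⟨h, ?_⟩
      simp only [Set.mem_singleton_iff, Sym2.eq_iff]
      tauto
    · intro v hv
      simp only [Walk.support_cons, List.mem_cons] at hv ⊢
      rcases hv with h | h
      · exact Or.inl h
      · exact Or.inr (hq v h)
    · rcases hc with hc | ⟨hc, hc'⟩
      · exact Or.inl hc
      · refine Or.inr ⟨hc, ?_⟩
        intro v hv
        simp only [Walk.support_cons, List.mem_cons] at hv
        rcases hv with rfl | h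
        · exact h1.1
        · exact hc' v h

lemma mgr_split {G : SimpleGraph V} (x y : V) {a b : V} (p : G.Walk a b) :
    (∃ q : (G.deleteEdges {s(x,y)}).Walk a b, ∀ v ∈ q.support, v ∈ p.support) ∨
    (∃ x' y', s(x',y') = s(x,y) ∧ x' ∈ p.support ∧ y' ∈ p.support ∧
      (∃ q : (G.deleteEdges {s(x,y)}).Walk a x', ∀ v ∈ q.support, v ∈ p.support) ∧
      (∃ q : (G.deleteEdges {s(x,y)}).Walk y' b, ∀ v ∈ q.support, v ∈ p.support)) := by
  induction p with
  | nil => exact Or.inl ⟨Walk.nil, by simp⟩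
  | cons h p ih =>
    rename_i u w z
    by_cases he : s(u,w) = s(x,y)
    · rcases ih with ⟨q, hq⟩ | ⟨x', y', hxy, hx', hy', ⟨q1, hq1⟩, ⟨q2, hq2⟩⟩
      · refine Or.inr ⟨u, w, he, by simp, by simp, ⟨Walk.nil, by simp⟩, ⟨q, ?_⟩⟩
        intro v hv; simp [hq v hv]
      · have : s(u,w) = s(x',y') := he.trans hxy.symm
        rw [Sym2.eq_iff] at this
        rcases this with ⟨rfl, rfl⟩ | ⟨rfl, rfl⟩
        · refine Or.inr ⟨u, w, he, by simp, by simp, ⟨Walk.nil, by simp⟩, ⟨q2, ?_⟩⟩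
          intro v hv; simp [hq2 v hv]
        · refine Or.inl ⟨q2, ?_⟩
          intro v hv; simp [hq2 v hv]
    · have hadj : (G.deleteEdges {s(x,y)}).Adj u w := by
        rw [deleteEdges_adj]; exact ⟨h, by simpa using he⟩
      rcases ih with ⟨q, hq⟩ | ⟨x', y', hxy, hx', hy', ⟨q1, hq1⟩, ⟨q2, hq2⟩⟩
      · refine Or.inl ⟨Walk.cons hadj q, ?_⟩
        intro v hv
        simp only [Walk.support_cons, List.mem_cons] at hv ⊢
        exact hv.imp id (hq v)
      · refine Or.inr ⟨x', y', hxy, by simp [hx'], by simp [hy'], ⟨Walk.cons hadj q1, ?_⟩, ⟨q2, ?_⟩⟩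
        · intro v hv
          simp only [Walk.support_cons, List.mem_cons] at hv ⊢
          exact hv.imp id (hq1 v)
        · intro v hv; simp [hq2 v hv]

/-- `T` meets every walk from `A` to `B`. -/
def Separates (G : SimpleGraph V) (A B T : Finset V) : Prop :=
  ∀ a ∈ A, ∀ b ∈ B, ∀ p : G.Walk a b, ∃ v ∈ p.support, v ∈ T

/-- There are `k` pairwise disjoint paths from `A` to `B`. -/
def Linked (G : SimpleGraph V) (A B : Finset V) (k : ℕ) : Prop :=
  ∃ (a b : Fin k → V) (p : ∀ i, G.Walk (a i) (b i)), (∀ i, a i ∈ A) ∧ (∀ i, b i ∈ B) ∧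
    (∀ i, (p i).IsPath) ∧ ∀ i j, ∀ v ∈ (p i).support, v ∈ (p j).support → i = j

lemma Separates.symm {G : SimpleGraph V} {A B T : Finset V} (h : Separates G A B T) :
    Separates G B A T := by
  intro a ha b hb p
  obtain ⟨v, hv, hv'⟩ := h b hb a ha p.reverse
  exact ⟨v, by simpa using hv, hv'⟩

lemma mgr_surj {k : ℕ} (C : Finset V) (hC : C.card = k) (b : Fin k → V) (hb : ∀ i, b i ∈ C)
    (hinj : Function.Injective b) : ∀ c ∈ C, ∃ i, b i = c := by
  classical
  intro c hc
  have : Finset.univ.image b = C := by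
    apply Finset.eq_of_subset_of_card_le
    · intro v hv
      simp only [Finset.mem_image] at hv
      obtain ⟨i, _, rfl⟩ := hv
      exact hb i
    · rw [Finset.card_image_of_injective _ hinj]; simp [hC]
  rw [← this] at hc
  simpa using hc

lemma mgr_core {G G' : SimpleGraph V} {k : ℕ} {A B S : Finset V} {x y : V}
    (hG' : G' = G.deleteEdges {s(x,y)}) (hadj : G.Adj x y)
    (ih : ∀ A B, (∀ T, Separates G' A B T → k ≤ T.card) → Linked G' A B k)
    (hT : ∀ T, Separates G A B T → k ≤ T.card)
    (hS : Separates G' A B S) (hSk : S.card < k) (hxS : x ∉ S) (hyS : y ∉ S)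
    (hax : ∃ a ∈ A, ∃ q : G'.Walk a x, ∀ v ∈ q.support, v ∉ S)
    (hby : ∃ b ∈ B, ∃ q : G'.Walk y b, ∀ v ∈ q.support, v ∉ S) : Linked G A B k := by
  classical
  have hle : G' ≤ G := hG' ▸ deleteEdges_le _
  have hAy : ∀ a ∈ A, ∀ q : G'.Walk a y, ∃ v ∈ q.support, v ∈ S := by
    intro a ha q
    obtain ⟨b0, hb0, q2, hq2⟩ := hby
    obtain ⟨v, hv, hv'⟩ := hS a ha b0 hb0 (q.append q2)
    rw [Walk.mem_support_append_iff] at hv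
    rcases hv with hv | hv
    · exact ⟨v, hv, hv'⟩
    · exact absurd hv' (hq2 v hv)
  have hBx : ∀ b ∈ B, ∀ q : G'.Walk b x, ∃ v ∈ q.support, v ∈ S := by
    intro b hb q
    obtain ⟨a0, ha0, q2, hq2⟩ := hax
    obtain ⟨v, hv, hv'⟩ := hS a0 ha0 b hb (q2.append q.reverse)
    rw [Walk.mem_support_append_iff] at hv
    rcases hv with hv | hv
    · exact absurd hv' (hq2 v hv)
    · exact ⟨v, by simpa using hv, hv'⟩
  have hdel : ∀ {a b : V} (p : G.Walk a b), (x ∉ p.support ∨ y ∉ p.support) →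
      ∃ q : G'.Walk a b, q.support = p.support := by
    intro a b p hp
    have : ∀ e ∈ p.edges, e ∈ G'.edgeSet := by
      intro e he
      rw [hG', edgeSet_deleteEdges]
      refine ⟨p.edges_subset_edgeSet he, ?_⟩
      rintro rfl
      rcases hp with hp | hp
      · exact hp (p.fst_mem_support_of_mem_edges he)
      · exact hp (p.snd_mem_support_of_mem_edges he)
    exact ⟨p.transfer G' this, by simp⟩
  have sepx : Separates G A B (insert x S) := by
    intro a ha b hb p
    by_contra hcon
    push Not at hcon
    obtain ⟨q, hq⟩ := hdel p (Or.inl fun h => hcon x h (by simp))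
    obtain ⟨v, hv, hv'⟩ := hS a ha b hb q
    exact hcon v (hq ▸ hv) (by simp [hv'])
  have sepy : Separates G A B (insert y S) := by
    intro a ha b hb p
    by_contra hcon
    push Not at hcon
    obtain ⟨q, hq⟩ := hdel p (Or.inr fun h => hcon y h (by simp))
    obtain ⟨v, hv, hv'⟩ := hS a ha b hb q
    exact hcon v (hq ▸ hv) (by simp [hv'])
  have cx : (insert x S).card = k := by
    have := hT _ sepx
    rw [Finset.card_insert_of_notMem hxS] at this ⊢
    omega
  have cy : (insert y S).card = k := by
    have := hT _ sepy
    rw [Finset.card_insert_of_notMem hyS] at this ⊢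
    omega
  obtain ⟨a, c, p, ha, hc, hp, hpd⟩ := ih A (insert x S) (by
    intro T hTs
    apply hT
    intro a ha b hb p
    obtain ⟨v, hv, hv'⟩ := sepx a ha b hb p
    obtain ⟨c, q, hq, hc⟩ := mgr_first S x y hyS p ⟨v, hv, by simpa [or_comm] using hv'⟩
    subst hG'
    rcases hc with hc | ⟨rfl, hc⟩
    · obtain ⟨w, hw, hw'⟩ := hTs a ha c (by simpa [or_comm] using hc) q
      exact ⟨w, hq w hw, hw'⟩
    · obtain ⟨w, hw, hw'⟩ := hAy a ha q
      exact absurd hw' (hc w hw))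
  obtain ⟨e, b, q, he, hb, hq, hqd⟩ := ih (insert y S) B (by
    intro T hTs
    apply hT
    intro a ha b hb p
    obtain ⟨v, hv, hv'⟩ := sepy a ha b hb p
    have hfirst := mgr_first S y x hxS p.reverse
      ⟨v, by simpa using hv, by simpa [or_comm] using hv'⟩
    have hsw : s(y,x) = s(x,y) := Sym2.eq_swap
    rw [hsw] at hfirst
    obtain ⟨c, q, hq, hc⟩ := hfirst
    subst hG'
    rcases hc with hc | ⟨rfl, hc⟩
    · obtain ⟨w, hw, hw'⟩ := hTs c (by simpa [or_comm] using hc) b hb q.reverse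
      have := hq w (by simpa using hw)
      exact ⟨w, by simpa using this, hw'⟩
    · obtain ⟨w, hw, hw'⟩ := hBx b hb q
      exact absurd hw' (hc w hw))
  have cinj : Function.Injective c := by
    intro i j hij
    exact hpd i j (c i) (Walk.end_mem_support _) (by rw [hij]; exact Walk.end_mem_support _)
  have einj : Function.Injective e := by
    intro i j hij
    exact hqd i j (e i) (Walk.start_mem_support _) (by rw [hij]; exact Walk.start_mem_support _)
  have csurj := mgr_surj _ cx c hc cinj
  have esurj := mgr_surj _ cy e he einj
  -- cross intersections
  have hcross : ∀ i j v, v ∈ (p i).support → v ∈ (q j).support → v ∈ S ∧ v = c i ∧ v = e j := by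
    intro i j v hv1 hv2
    have hci : ∀ w ∈ S, w ∈ (p i).support → w = c i := by
      intro w hw hw'
      obtain ⟨m, rfl⟩ := csurj w (by simp [hw])
      rw [hpd m i (c m) (Walk.end_mem_support _) hw']
    have hej : ∀ w ∈ S, w ∈ (q j).support → w = e j := by
      intro w hw hw'
      obtain ⟨m, rfl⟩ := esurj w (by simp [hw])
      rw [hqd m j (e m) (Walk.start_mem_support _) hw']
    by_cases hvS : v ∈ S
    · exact ⟨hvS, hci v hvS hv1, hej v hvS hv2⟩
    exfalso
    obtain ⟨w, hw, hwS⟩ := hS (a i) (ha i) (b j) (hb j)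
      (((p i).takeUntil v hv1).append ((q j).dropUntil v hv2))
    rw [Walk.mem_support_append_iff] at hw
    rcases hw with hw | hw
    · have h1 := hci w hwS (Walk.support_takeUntil_subset_support _ _ hw)
      have h2 : v ≠ c i := by rintro rfl; exact hvS (h1 ▸ hwS)
      rw [h1] at hw
      exact Walk.endpoint_notMem_support_takeUntil (hp i) hv1 h2.symm hw
    · have h1 := hej w hwS (Walk.support_dropUntil_subset_support _ _ hw)
      have h2 : v ≠ e j := by rintro rfl; exact hvS (h1 ▸ hwS)
      rw [h1] at hw
      have h3 := (hq j)
      rw [← Walk.take_spec (q j) hv2, ] at h3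
      have h4 := h3.ne_of_mem_support_of_append (x := e j) (y := e j) (by
        intro h; exact h2 h.symm) (Walk.start_mem_support _) hw
      exact h4 rfl
  -- joining
  have hjoin : ∀ i, ∃ j, ∃ w : G.Walk (a i) (b j), w.IsPath ∧
      (∀ v ∈ w.support, v ∈ (p i).support ∨ v ∈ (q j).support) ∧
      ((c i ∈ S ∧ e j = c i) ∨ (c i = x ∧ e j = y)) := by
    intro i
    have hci := hc i
    rw [Finset.mem_insert] at hci
    rcases hci with hci | hci
    · obtain ⟨j, hj⟩ := esurj y (by simp)
      refine ⟨j, ((((p i).mapLe hle).append (Walk.cons (by rw [hci, hj]; exact hadj) Walk.nil)).append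
        ((q j).mapLe hle)).bypass, Walk.bypass_isPath _, ?_, Or.inr ⟨hci, hj⟩⟩
      intro v hv
      have := Walk.support_bypass_subset_support _ hv
      simp only [Walk.mem_support_append_iff, Walk.support_mapLe_eq_support, Walk.support_cons,
        Walk.support_nil, List.mem_cons, List.not_mem_nil, or_false] at this
      rcases this with (h | rfl | rfl) | h
      · exact Or.inl h
      · exact Or.inl (Walk.end_mem_support _)
      · exact Or.inr (Walk.start_mem_support _)
      · exact Or.inr h
    · obtain ⟨j, hj⟩ := esurj (c i) (by simp [hci])
      refine ⟨j, (((p i).mapLe hle).append (((q j).mapLe hle).copy hj rfl)).bypass,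
        Walk.bypass_isPath _, ?_, Or.inl ⟨hci, hj⟩⟩
      intro v hv
      have := Walk.support_bypass_subset_support _ hv
      simpa using this
  choose J w hw hws hJ using hjoin
  have Jinj : ∀ i i', e (J i) = e (J i') → i = i' := by
    intro i i' h
    apply cinj
    rcases hJ i with ⟨h1, h2⟩ | ⟨h1, h2⟩ <;> rcases hJ i' with ⟨h3, h4⟩ | ⟨h3, h4⟩
    · rw [← h2, ← h4, h]
    · exact absurd h1 (by rw [← h2, h, h4]; exact hyS)
    · exact absurd h3 (by rw [← h4, ← h, h2]; exact hyS)
    · rw [h1, h3]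
  have key : ∀ i i' v, v ∈ (p i).support → v ∈ (q (J i')).support → i = i' := by
    intro i i' v h1 h2
    obtain ⟨h3, h4, h5⟩ := hcross _ _ _ h1 h2
    apply Jinj
    rcases hJ i with ⟨h6, h7⟩ | ⟨h6, h7⟩
    · rw [h7, ← h4, h5]
    · exact absurd h3 (by rw [h4, h6]; exact hxS)
  refine ⟨a, fun i => b (J i), w, ha, fun i => hb _, hw, ?_⟩
  intro i i' v h1 h2
  rcases hws i v h1 with h1 | h1 <;> rcases hws i' v h2 with h2 | h2
  · exact hpd _ _ _ h1 h2
  · exact key _ _ _ h1 h2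
  · exact (key _ _ _ h2 h1).symm
  · exact Jinj _ _ (by rw [hqd _ _ _ h1 h2])

theorem menger [Fintype V] (k : ℕ) : ∀ (m : ℕ) (G : SimpleGraph V) (A B : Finset V),
    G.edgeSet.ncard = m → (∀ T, Separates G A B T → k ≤ T.card) → Linked G A B k := by
  classical
  intro m
  induction m using Nat.strong_induction_on with
  | _ m ih =>
  intro G A B hm hT
  by_cases hbot : ∀ x y, ¬ G.Adj x y
  · have hk : k ≤ (A ∩ B).card := by
      apply hT
      intro a ha b hb p
      cases p with
      | nil => exact ⟨a, by simp, by simp [ha, hb]⟩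
      | cons h p => exact absurd h (hbot _ _)
    obtain ⟨f, hf⟩ : ∃ f : Fin k → V, Function.Injective f ∧ ∀ i, f i ∈ A ∩ B := by
      obtain ⟨D, hD, hDk⟩ := Finset.exists_subset_card_eq hk
      exact ⟨fun i => (D.equivFinOfCardEq hDk).symm i,
        fun i j h => by simpa [Subtype.coe_inj] using h,
        fun i => hD ((D.equivFinOfCardEq hDk).symm i).2⟩
    refine ⟨f, f, fun i => Walk.nil, fun i => (Finset.mem_inter.1 (hf.2 i)).1,
      fun i => (Finset.mem_inter.1 (hf.2 i)).2, fun i => by simp, ?_⟩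
    intro i j v h1 h2
    simp at h1 h2
    exact hf.1 (h1.symm.trans h2)
  push Not at hbot
  obtain ⟨x0, y0, he⟩ := hbot
  set G' := G.deleteEdges {s(x0,y0)} with hG'
  have hle : G' ≤ G := deleteEdges_le _
  have hlt : G'.edgeSet.ncard < m := by
    rw [← hm]
    apply Set.ncard_lt_ncard _ (Set.toFinite _)
    rw [edgeSet_ssubset_edgeSet]
    refine lt_of_le_of_ne hle ?_
    intro h
    have : G'.Adj x0 y0 := by rw [h]; exact he
    simp [hG', deleteEdges_adj] at this
  by_cases hT' : ∀ T, Separates G' A B T → k ≤ T.card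
  · obtain ⟨a, b, p, ha, hb, hp, hd⟩ := ih _ hlt G' A B rfl hT'
    refine ⟨a, b, fun i => (p i).mapLe hle, ha, hb, fun i => (Walk.isPath_mapLe hle).2 (hp i), ?_⟩
    intro i j v h1 h2
    simp at h1 h2
    exact hd i j v h1 h2
  push Not at hT'
  obtain ⟨S, hS, hSk⟩ := hT'
  have hSn : ¬ Separates G A B S := fun h => absurd (hT S h) (by omega)
  unfold Separates at hSn
  push Not at hSn
  obtain ⟨a0, ha0, b0, hb0, p0, hp0⟩ := hSn
  rcases mgr_split x0 y0 p0 with ⟨q, hq⟩ | ⟨x, y, hxy, hx', hy', ⟨q1, hq1⟩, ⟨q2, hq2⟩⟩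
  · obtain ⟨v, hv, hv'⟩ := hS a0 ha0 b0 hb0 q
    exact absurd hv' (hp0 v (hq v hv))
  have hG2 : G' = G.deleteEdges {s(x,y)} := by rw [hG', hxy]
  have hadj : G.Adj x y := by
    rw [← mem_edgeSet, hxy]; exact he
  exact mgr_core hG2 hadj (fun A B h => ih _ hlt G' A B rfl h) hT hS hSk (hp0 _ hx') (hp0 _ hy')
    ⟨a0, ha0, q1, fun v hv => hp0 v (hq1 v hv)⟩ ⟨b0, hb0, q2, fun v hv => hp0 v (hq2 v hv)⟩

end Menger
section Exchange

variable {V : Type}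

/-- The number of vertices of `S` on `X` up to the first visit of `u`. -/
noncomputable def lab [DecidableEq V] {G : SimpleGraph V} {x : V} (X : G.Walk x x) (S : Finset V)
    (u : V) : ℕ :=
  if hu : u ∈ X.support then ((X.takeUntil u hu).support.toFinset ∩ S).card else 0

lemma lab_le [DecidableEq V] {G : SimpleGraph V} {x : V} (X : G.Walk x x) (S : Finset V)
    (u : V) : lab X S u ≤ S.card := by
  unfold lab
  split_ifs
  · exact Finset.card_le_card Finset.inter_subset_right
  · exact Nat.zero_le _

/-- A decomposition of a cycle in two arcs, the first of which avoids `S`. -/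
def HasArcs {G : SimpleGraph V} {x : V} (X : G.Walk x x) (S : Finset V) (u v : V) : Prop :=
  ∃ (P : G.Walk u v) (P' : G.Walk v u), P.IsPath ∧ P'.IsPath ∧
    P'.support.tail.Disjoint P.support.tail ∧
    P.length + P'.length = X.length ∧ (∀ w ∈ P.support, w ∈ X.support) ∧
    (∀ w ∈ P'.support, w ∈ X.support) ∧ ∀ w ∈ P.support, w ∉ S

lemma tail_disj {G : SimpleGraph V} {u v : V} {P : G.Walk u v} {P' : G.Walk v u}
    (h1 : P.IsPath) (h2 : P'.IsPath) (h : ∀ w, w ∈ P.support → w ∈ P'.support → w = u ∨ w = v) :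
    P.support.tail.Disjoint P'.support.tail := by
  intro w hw hw'
  have n1 := h1.support_nodup
  have n2 := h2.support_nodup
  rw [← Walk.cons_tail_support] at n1 n2
  rcases h w (List.mem_of_mem_tail hw) (List.mem_of_mem_tail hw') with rfl | rfl
  · exact (List.nodup_cons.1 n1).1 hw
  · exact (List.nodup_cons.1 n2).1 hw'

lemma disj_tail {G : SimpleGraph V} {u v : V} {P : G.Walk u v} {P' : G.Walk v u}
    (h : P.support.tail.Disjoint P'.support.tail) :
    ∀ w, w ∈ P.support → w ∈ P'.support → w = u ∨ w = v := by
  intro w h1 h2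
  rw [← Walk.cons_tail_support, List.mem_cons] at h1 h2
  rcases h1 with h1 | h1
  · exact Or.inl h1
  rcases h2 with h2 | h2
  · exact Or.inr h2
  exact absurd h2 (h h1)

lemma HasArcs.symm {G : SimpleGraph V} {x : V} {X : G.Walk x x} {S : Finset V} {u v : V}
    (h : HasArcs X S u v) : HasArcs X S v u := by
  obtain ⟨P, P', h1, h2, h3, h4, h5, h6, h7⟩ := h
  refine ⟨P.reverse, P'.reverse, h1.reverse, h2.reverse, ?_, by simpa using h4,
    by simpa using h5, by simpa using h6, by simpa using h7⟩
  apply tail_disj h2.reverse h1.reverse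
  intro w hw hw'
  have := disj_tail h3 w (by simpa using hw) (by simpa using hw')
  tauto

lemma arc_aux [DecidableEq V] {G : SimpleGraph V} {x : V} {X : G.Walk x x} (hX : X.IsCycle)
    {S : Finset V} {u v : V} (hu : u ∈ X.support) (hv : v ∈ X.support) (huv : u ≠ v)
    (huS : u ∉ S) (hl : lab X S u = lab X S v)
    (hlt : u ∈ (X.takeUntil v hv).support) : HasArcs X S u v := by
  have hvp : (X.takeUntil v hv).IsPath := hX.isPath_takeUntil hv
  set Tv := X.takeUntil v hv with hTv
  set D := X.dropUntil v hv with hD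
  set T := Tv.takeUntil u hlt with hT
  set R := Tv.dropUntil u hlt with hR
  have e1 : T = X.takeUntil u hu := Walk.takeUntil_takeUntil X hv hlt
  have e2 : T.append R = Tv := Walk.take_spec _ _
  have hcyc : (X.rotate v hv).IsCycle := (Walk.isCycle_rotate hv).2 hX
  have e3 : X.rotate v hv = (D.append T).append R := by
    rw [Walk.rotate, ← hTv, ← hD, ← e2, Walk.append_assoc]
  rw [e3] at hcyc
  have hRn : ¬ R.Nil := fun h => huv h.eq
  have hR1 : R.IsPath := hvp.dropUntil hlt
  have hP' : (D.append T).IsPath := hcyc.isPath_of_append_left hRn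
  refine ⟨R, D.append T, hR1, hP', ?_, ?_, ?_, ?_, ?_⟩
  · have := hcyc.support_nodup
    rw [Walk.tail_support_append] at this
    exact List.disjoint_of_nodup_append this
  · have h1 : X.length = Tv.length + D.length := by
      rw [← Walk.length_append, hTv, hD, Walk.take_spec]
    have h2 : Tv.length = T.length + R.length := by rw [← Walk.length_append, e2]
    rw [Walk.length_append]; omega
  · intro w hw
    exact Walk.support_takeUntil_subset_support _ hv (Walk.support_dropUntil_subset_support _ hlt hw)
  · intro w hw
    rw [Walk.mem_support_append_iff] at hw
    rcases hw with hw | hw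
    · exact Walk.support_dropUntil_subset_support _ hv hw
    · exact Walk.support_takeUntil_subset_support _ hv (Walk.support_takeUntil_subset_support _ hlt hw)
  · intro w hw hwS
    have hsub : T.support.toFinset ∩ S ⊆ Tv.support.toFinset ∩ S := by
      intro z hz
      simp only [Finset.mem_inter, List.mem_toFinset] at hz ⊢
      exact ⟨Walk.support_takeUntil_subset_support _ hlt hz.1, hz.2⟩
    have heq := Finset.eq_of_subset_of_card_le hsub (by
      simp only [lab, hu, hv, dif_pos] at hl
      rw [e1, hl])
    have : w ∈ Tv.support.toFinset ∩ S := by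
      simp only [Finset.mem_inter, List.mem_toFinset]
      exact ⟨Walk.support_dropUntil_subset_support _ hlt hw, hwS⟩
    rw [← heq] at this
    simp only [Finset.mem_inter, List.mem_toFinset] at this
    rw [← e2] at hvp
    have hne : w ≠ u := by rintro rfl; exact huS hwS
    exact hvp.ne_of_mem_support_of_append hne this.1 hw rfl

lemma arc_exists [DecidableEq V] {G : SimpleGraph V} {x : V} {X : G.Walk x x} (hX : X.IsCycle)
    {S : Finset V} {u v : V} (hu : u ∈ X.support) (hv : v ∈ X.support) (huv : u ≠ v)
    (huS : u ∉ S) (hvS : v ∉ S) (hl : lab X S u = lab X S v) : HasArcs X S u v := by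
  rcases List.prefix_or_prefix_of_prefix (Walk.support_takeUntil_prefix_support X hu)
    (Walk.support_takeUntil_prefix_support X hv) with h | h
  · exact arc_aux hX hu hv huv huS hl (h.subset (Walk.end_mem_support _))
  · exact (arc_aux hX hv hu huv.symm hvS hl.symm (h.subset (Walk.end_mem_support _))).symm

lemma path_append {G : SimpleGraph V} {u v w : V} {p : G.Walk u v} {q : G.Walk v w}
    (hp : p.IsPath) (hq : q.IsPath) (h : ∀ z, z ∈ p.support → z ∈ q.support → z = v) :
    (p.append q).IsPath := by
  rw [Walk.isPath_def, Walk.support_append]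
  have n2 := hq.support_nodup
  rw [← Walk.cons_tail_support] at n2
  refine List.Nodup.append hp.support_nodup (List.nodup_cons.1 n2).2 ?_
  intro z h1 h2
  have := h z h1 (List.mem_of_mem_tail h2)
  subst this
  exact (List.nodup_cons.1 n2).1 h2

lemma exch_one {G : SimpleGraph V} {x1 x2 y1 y2 : V} {P' : G.Walk x2 x1} {Q : G.Walk y1 y2}
    {p1 : G.Walk x1 y1} {p2 : G.Walk x2 y2} (hP' : P'.IsPath) (hQ : Q.IsPath) (hp1 : p1.IsPath)
    (hp2 : p2.IsPath) (h1 : ∀ z ∈ P'.support, z ∉ Q.support)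
    (h2 : ∀ z ∈ P'.support, z ∈ p1.support → z = x1)
    (h3 : ∀ z ∈ P'.support, z ∈ p2.support → z = x2)
    (h4 : ∀ z ∈ Q.support, z ∈ p1.support → z = y1)
    (h5 : ∀ z ∈ Q.support, z ∈ p2.support → z = y2)
    (h6 : ∀ z ∈ p1.support, z ∉ p2.support) :
    ∃ W : G.Walk x2 x2, W.IsCycle ∧ W.length = P'.length + p1.length + Q.length + p2.length := by
  have a1 : (p1.append Q).IsPath := path_append hp1 hQ fun z hz hz' => h4 z hz' hz
  have a2 : ((p1.append Q).append p2.reverse).IsPath := by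
    refine path_append a1 hp2.reverse fun z hz hz' => ?_
    rw [Walk.support_reverse, List.mem_reverse] at hz'
    rw [Walk.mem_support_append_iff] at hz
    rcases hz with hz | hz
    · exact absurd hz' (h6 z hz)
    · exact h5 z hz hz'
  refine ⟨P'.append ((p1.append Q).append p2.reverse), ?_, ?_⟩
  · apply hP'.isCycle_append a2
    · apply tail_disj hP' a2
      intro w hw hw'
      simp only [Walk.mem_support_append_iff, Walk.support_reverse, List.mem_reverse] at hw'
      rcases hw' with (h | h) | h
      · exact Or.inr (h2 w hw h)
      · exact absurd h (h1 w hw)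
      · exact Or.inl (h3 w hw h)
    · right
      have b1 : p1.length ≠ 0 := by
        intro h
        have := Walk.eq_of_length_eq_zero h
        subst this
        exact h1 _ (Walk.end_mem_support _) (Walk.start_mem_support _)
      have b2 : p2.length ≠ 0 := by
        intro h
        have := Walk.eq_of_length_eq_zero h
        subst this
        exact h1 _ (Walk.start_mem_support _) (Walk.end_mem_support _)
      simp only [Walk.length_append, Walk.length_reverse]
      omega
  · simp only [Walk.length_append, Walk.length_reverse]
    omega

/-- A path from `A` to `B` that meets `A` and `B` only in its ends. -/
lemma shorten {G : SimpleGraph V} (A B : Finset V) {a b : V} (p : G.Walk a b) (ha : a ∈ A)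
    (hb : b ∈ B) : ∃ a' b', ∃ q : G.Walk a' b', a' ∈ A ∧ b' ∈ B ∧ q.IsPath ∧
      (∀ v ∈ q.support, v ∈ p.support) ∧ (∀ v ∈ q.support, v ∈ A → v = a') ∧
      (∀ v ∈ q.support, v ∈ B → v = b') := by
  classical
  have hex : ∃ m, ∃ a' b', ∃ q : G.Walk a' b', a' ∈ A ∧ b' ∈ B ∧
    (∀ v ∈ q.support, v ∈ p.support) ∧ q.length = m := ⟨_, a, b, p, ha, hb, fun _ h => h, rfl⟩
  obtain ⟨a', b', q, ha', hb', hq, hm⟩ := Nat.find_spec hex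
  have hmin := fun m (h : m < Nat.find hex) => Nat.find_min hex h
  rw [← hm] at hmin
  have hqp : q.IsPath := by
    have h1 : ¬ q.bypass.length < q.length := fun h => hmin _ h
      ⟨a', b', q.bypass, ha', hb', fun v hv => hq v (Walk.support_bypass_subset_support _ hv), rfl⟩
    have := Walk.bypass_eq_self_of_length_le_length_bypass q (by omega)
    rw [← this]
    exact Walk.bypass_isPath _
  refine ⟨a', b', q, ha', hb', hqp, hq, ?_, ?_⟩
  · intro v hv hvA
    by_contra hne
    refine hmin (q.dropUntil v hv).length ?_ ⟨v, b', q.dropUntil v hv, hvA, hb', fun w hw =>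
      hq w (Walk.support_dropUntil_subset_support _ hv hw), rfl⟩
    have h1 : q.length = (q.takeUntil v hv).length + (q.dropUntil v hv).length := by
      rw [← Walk.length_append, Walk.take_spec]
    have h2 : (q.takeUntil v hv).length ≠ 0 := fun h => hne (Walk.eq_of_length_eq_zero h).symm
    omega
  · intro v hv hvB
    by_contra hne
    refine hmin (q.takeUntil v hv).length ?_ ⟨a', v, q.takeUntil v hv, ha', hvB, fun w hw =>
      hq w (Walk.support_takeUntil_subset_support _ hv hw), rfl⟩
    exact Walk.length_takeUntil_lt_length hv hne

theorem exchange [DecidableEq V] {G : SimpleGraph V} {x y : V} {X : G.Walk x x} {Y : G.Walk y y}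
    (hX : IsLongestCycle G X) (hY : IsLongestCycle G Y) (k : ℕ)
    (hk : (X.support.toFinset ∩ Y.support.toFinset).card = k)
    (hL : Linked G X.support.toFinset Y.support.toFinset ((k + 1) ^ 2 + k + 1)) : False := by
  classical
  set A := X.support.toFinset with hA
  set B := Y.support.toFinset with hB
  set S := A ∩ B with hS
  obtain ⟨a0, b0, p0, ha0, hb0, -, hd0⟩ := hL
  choose a b p ha hb hp hsub hpA hpB using fun i => shorten A B (p0 i) (ha0 i) (hb0 i)
  have hd : ∀ i j, ∀ v ∈ (p i).support, v ∈ (p j).support → i = j := fun i j v h1 h2 =>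
    hd0 i j v (hsub i v h1) (hsub j v h2)
  have ainj : Function.Injective a := fun i j h =>
    hd i j (a i) (Walk.start_mem_support _) (by rw [h]; exact Walk.start_mem_support _)
  -- trivial indices
  set I : Finset (Fin ((k + 1) ^ 2 + k + 1)) := Finset.univ.filter fun i => a i ∈ B with hI
  have hIk : I.card ≤ k := by
    refine le_trans ?_ hk.le
    apply Finset.card_le_card_of_injOn a
    · intro i hi
      simp only [hI, Finset.coe_filter, Set.mem_ofPred_eq] at hi
      simp [hS, ha i, hi.2]
    · exact ainj.injOn
  have hIc : (k + 1) ^ 2 < Iᶜ.card := by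
    rw [Finset.card_compl, Fintype.card_fin]; omega
  obtain ⟨i, hi, j, hj, hij, hlab⟩ := Finset.exists_ne_map_eq_of_card_lt_of_maps_to
    (s := Iᶜ) (t := Finset.range (k+1) ×ˢ Finset.range (k+1))
    (by rw [Finset.card_product, Finset.card_range]; nlinarith)
    (f := fun i => (lab X S (a i), lab Y S (b i))) (by
      intro i hi
      have h1 := lab_le X S (a i)
      have h2 := lab_le Y S (b i)
      simp only [Finset.coe_product, Finset.coe_range, Set.mem_prod, Set.mem_Iio]
      omega)
  simp only [Prod.mk.injEq] at hlab
  have hnt : ∀ i, i ∈ Iᶜ → a i ∉ B ∧ b i ∉ A := by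
    intro i hi
    have : a i ∉ B := by simpa [hI] using hi
    refine ⟨this, fun h => this ?_⟩
    rw [← hpA i _ (Walk.end_mem_support _) h]; exact hb i
  obtain ⟨hai, hbi⟩ := hnt i hi
  obtain ⟨haj, hbj⟩ := hnt j hj
  have memA : ∀ v, v ∈ A ↔ v ∈ X.support := by intro v; simp [hA]
  have memB : ∀ v, v ∈ B ↔ v ∈ Y.support := by intro v; simp [hB]
  have bij : b i ≠ b j := fun h => hij
    (hd i j (b i) (Walk.end_mem_support _) (by rw [h]; exact Walk.end_mem_support _))
  obtain ⟨P, P', hP, hP', hPd, hPl, hPs, hPs', hPS⟩ := arc_exists (S := S) hX.1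
    ((memA _).1 (ha i)) ((memA _).1 (ha j)) (fun h => hij (ainj h)) (by simp [hS, hai])
    (by simp [hS, haj]) hlab.1
  obtain ⟨Q, Q', hQ, hQ', hQd, hQl, hQs, hQs', hQS⟩ := arc_exists (S := S) hY.1
    ((memB _).1 (hb i)) ((memB _).1 (hb j)) bij (by simp [hS, hbi])
    (by simp [hS, hbj]) hlab.2
  have hPB : ∀ w ∈ P.support, w ∉ B := fun w hw hwB =>
    hPS w hw (Finset.mem_inter.2 ⟨(memA _).2 (hPs w hw), hwB⟩)
  have hQA : ∀ w ∈ Q.support, w ∉ A := fun w hw hwA =>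
    hQS w hw (Finset.mem_inter.2 ⟨hwA, (memB _).2 (hQs w hw)⟩)
  obtain ⟨W1, hW1, l1⟩ := exch_one hP' hQ (hp i) (hp j)
    (fun z hz hz' => hQA z hz' ((memA _).2 (hPs' z hz)))
    (fun z hz hz' => hpA i z hz' ((memA _).2 (hPs' z hz)))
    (fun z hz hz' => hpA j z hz' ((memA _).2 (hPs' z hz)))
    (fun z hz hz' => hpB i z hz' ((memB _).2 (hQs z hz)))
    (fun z hz hz' => hpB j z hz' ((memB _).2 (hQs z hz)))
    (fun z hz hz' => hij (hd i j z hz hz'))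
  obtain ⟨W2, hW2, l2⟩ := exch_one hQ' hP (hp i).reverse (hp j).reverse
    (fun z hz hz' => hPB z hz' ((memB _).2 (hQs' z hz)))
    (fun z hz hz' => hpB i z (by simpa using hz') ((memB _).2 (hQs' z hz)))
    (fun z hz hz' => hpB j z (by simpa using hz') ((memB _).2 (hQs' z hz)))
    (fun z hz hz' => hpA i z (by simpa using hz') ((memA _).2 (hPs z hz)))
    (fun z hz hz' => hpA j z (by simpa using hz') ((memA _).2 (hPs z hz)))
    (fun z hz hz' => hij (hd i j z (by simpa using hz) (by simpa using hz')))
  have m1 := hX.2 _ W1 hW1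
  have m2 := hY.2 _ W2 hW2
  simp only [Walk.length_reverse] at l2
  have b1 : (p i).length ≠ 0 := by
    intro h
    have := Walk.eq_of_length_eq_zero h
    exact hai (this ▸ hb i)
  omega

end Exchange
section Swap

variable {V : Type}

lemma cycle_card [DecidableEq V] {G : SimpleGraph V} {x : V} {p : G.Walk x x}
    (hp : p.IsCycle) : p.support.toFinset.card = p.length := by
  have e2 : p.support.toFinset = p.support.tail.toFinset := by
    ext w
    simp only [List.mem_toFinset]
    constructor
    · intro hw
      rw [← Walk.cons_tail_support, List.mem_cons] at hw
      rcases hw with rfl | hw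
      · exact Walk.end_mem_tail_support hp.not_nil
      · exact hw
    · exact List.mem_of_mem_tail
  rw [e2, List.toFinset_card_of_nodup hp.support_nodup]
  simp

/-- `C` is (the edge set of) a cycle of `G` with vertex set `K`. -/
structure CG (G C : SimpleGraph V) (K : Finset V) : Prop where
  le : C ≤ G
  deg : ∀ v ∈ K, (C.neighborSet v).ncard = 2
  sup : ∀ u v, C.Adj u v → u ∈ K
  conn : ∀ u ∈ K, ∀ v ∈ K, C.Reachable u v

lemma CG.cycle [Fintype V] [DecidableEq V] {G C : SimpleGraph V} {K : Finset V} (h : CG G C K)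
    (hK : K.Nonempty) : ∃ x, ∃ W : G.Walk x x, W.IsCycle ∧ W.length = K.card := by
  obtain ⟨v, hv⟩ := hK
  have hc : C.IsCycles := by
    intro u hu
    obtain ⟨w, hw⟩ := hu
    exact h.deg u (h.sup u w hw)
  obtain ⟨p, hp, hpv⟩ := hc.exists_cycle_toSubgraph_verts_eq_connectedComponentSupp
    (v := v) (c := C.connectedComponentMk v) (by simp) (by
      have := h.deg v hv
      apply Set.nonempty_of_ncard_ne_zero
      omega)
  refine ⟨v, p.mapLe h.le, (Walk.isCycle_mapLe h.le).2 hp, ?_⟩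
  have e : p.support.toFinset = K := by
    ext w
    rw [List.mem_toFinset, ← Walk.mem_verts_toSubgraph, hpv, ConnectedComponent.mem_supp_iff,
      ConnectedComponent.eq]
    constructor
    · intro hw
      obtain ⟨q⟩ := hw
      cases q with
      | nil => exact hv
      | cons h1 _ => exact h.sup _ _ h1
    · intro hw
      exact h.conn w hw v hv
  refine Eq.trans ?_ (congrArg Finset.card e)
  rw [cycle_card hp]
  simp

lemma CG.of_cycle [DecidableEq V] {G : SimpleGraph V} {x : V} {p : G.Walk x x}
    (hp : p.IsCycle) : CG G p.toSubgraph.spanningCoe p.support.toFinset := by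
  refine ⟨Subgraph.spanningCoe_le _, ?_, ?_, ?_⟩
  · intro v hv
    exact hp.ncard_neighborSet_toSubgraph_eq_two (by simpa using hv)
  · intro u v huv
    have := p.toSubgraph.edge_vert huv
    rw [Walk.mem_verts_toSubgraph] at this
    simpa using this
  · intro u hu v hv
    have h1 := p.toSubgraph_connected.preconnected
    have := h1 ⟨u, by simpa using hu⟩ ⟨v, by simpa using hv⟩
    exact this.map (⟨Subtype.val, fun h => h⟩ : p.toSubgraph.coe →g p.toSubgraph.spanningCoe)

/-- Edges touching `D`. -/
def inG (C : SimpleGraph V) (D : Finset V) : SimpleGraph V where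
  Adj u v := C.Adj u v ∧ (u ∈ D ∨ v ∈ D)
  symm := ⟨fun _ _ h => ⟨h.1.symm, h.2.symm⟩⟩
  loopless := ⟨fun u h => C.loopless.irrefl u h.1⟩

/-- Edges not touching `D`. -/
def outG (C : SimpleGraph V) (D : Finset V) : SimpleGraph V where
  Adj u v := C.Adj u v ∧ u ∉ D ∧ v ∉ D
  symm := ⟨fun _ _ h => ⟨h.1.symm, h.2.symm⟩⟩
  loopless := ⟨fun u h => C.loopless.irrefl u h.1⟩

lemma exit_aux {G C : SimpleGraph V} {D S : Finset V}
    (hDS : ∀ u ∈ D, ∀ v, G.Adj u v → v ∈ D ∨ v ∈ S) (hle : C ≤ G) {u v : V} (p : C.Walk u v)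
    (hu : u ∈ D) (hv : v ∉ D) : ∃ s ∈ S, s ∉ D ∧ (inG C D).Reachable u s ∧ ∃ w, (inG C D).Adj s w := by
  induction p with
  | nil => exact absurd hu hv
  | cons h p ih =>
    rename_i u w z
    have ha : (inG C D).Adj u w := ⟨h, Or.inl hu⟩
    by_cases hw : w ∈ D
    · obtain ⟨s, hs, hs', hr, hn⟩ := ih hw hv
      exact ⟨s, hs, hs', ha.reachable.trans hr, hn⟩
    · refine ⟨w, (hDS u hu w (hle h)).resolve_left hw, hw, ha.reachable, u, ha.symm⟩

lemma reach_aux {G C H : SimpleGraph V} {D S : Finset V}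
    (hDS : ∀ u ∈ D, ∀ v, G.Adj u v → v ∈ D ∨ v ∈ S) (hle : C ≤ G)
    (hout : outG C D ≤ H)
    (hin : ∀ u ∈ S, ∀ v ∈ S, (inG C D).Reachable u v → H.Reachable u v)
    {u v : V} (p : C.Walk u v) (hv : v ∉ D) :
    (u ∉ D → H.Reachable u v) ∧
    (u ∈ D → ∃ s ∈ S, (inG C D).Reachable u s ∧ H.Reachable s v) := by
  induction p with
  | nil => exact ⟨fun _ => Reachable.refl _, fun h => absurd h hv⟩
  | cons h p ih =>
    rename_i u w z
    obtain ⟨i1, i2⟩ := ih hv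
    constructor
    · intro hu
      by_cases hw : w ∈ D
      · obtain ⟨s, hs, h1, h2⟩ := i2 hw
        have huS : u ∈ S := (hDS w hw u (hle h.symm)).resolve_left hu
        have ha : (inG C D).Adj u w := ⟨h, Or.inr hw⟩
        exact (hin u huS s hs (ha.reachable.trans h1)).trans h2
      · have ha : (outG C D).Adj u w := ⟨h, hu, hw⟩
        exact (hout ha).reachable.trans (i1 hw)
    · intro hu
      have ha : (inG C D).Adj u w := ⟨h, Or.inl hu⟩
      by_cases hw : w ∈ D
      · obtain ⟨s, hs, h1, h2⟩ := i2 hw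
        exact ⟨s, hs, ha.reachable.trans h1, h2⟩
      · exact ⟨w, (hDS u hu w (hle h)).resolve_left hw, ha.reachable, i1 hw⟩

theorem swap [Fintype V] [DecidableEq V] {G C1 C2 : SimpleGraph V} {D S K1 K2 : Finset V}
    (hDS : ∀ u ∈ D, ∀ v, G.Adj u v → v ∈ D ∨ v ∈ S)
    (h1 : CG G C1 K1) (h2 : CG G C2 K2) (L : ℕ) (hL1 : K1.card = L) (hL2 : K2.card = L)
    (hmax : ∀ (y : V) (W : G.Walk y y), W.IsCycle → W.length ≤ L)
    (hmeet : ∃ z ∈ K1, z ∈ K2)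
    (hdeg : ∀ s ∈ S, s ∉ D → ((inG C1 D).neighborSet s).ncard = ((inG C2 D).neighborSet s).ncard)
    (hreach : ∀ u ∈ S, ∀ v ∈ S, (inG C2 D).Reachable u v → (inG C1 D).Reachable u v) :
    (K1 ∩ D).card ≤ (K2 ∩ D).card := by
  -- degree condition outside D
  have hemp : ∀ C : SimpleGraph V, C ≤ G → ∀ v, v ∉ D → v ∉ S → (inG C D).neighborSet v = ∅ := by
    intro C hC v hv hvS
    ext w
    simp only [mem_neighborSet, Set.mem_empty_iff_false, iff_false]
    rintro ⟨ha, hb⟩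
    have hw := hb.resolve_left hv
    rcases hDS w hw v (hC ha.symm) with h | h
    · exact hv h
    · exact hvS h
  have hdeg' : ∀ v, v ∉ D → ((inG C1 D).neighborSet v).ncard = ((inG C2 D).neighborSet v).ncard := by
    intro v hv
    by_cases hvS : v ∈ S
    · exact hdeg v hvS hv
    · rw [hemp C1 h1.le v hv hvS, hemp C2 h2.le v hv hvS]
  set H : SimpleGraph V := inG C1 D ⊔ outG C2 D with hH
  have nD : ∀ v ∈ D, H.neighborSet v = C1.neighborSet v := by
    intro v hv
    ext w
    simp [hH, inG, outG, hv]
  have nO : ∀ v, v ∉ D → (H.neighborSet v).ncard = (C2.neighborSet v).ncard := by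
    intro v hv
    have e1 : H.neighborSet v = (inG C1 D).neighborSet v ∪ (outG C2 D).neighborSet v := by
      ext w; simp [hH]
    have e2 : C2.neighborSet v = (inG C2 D).neighborSet v ∪ (outG C2 D).neighborSet v := by
      ext w
      simp only [mem_neighborSet, inG, outG, Set.mem_union, hv]
      tauto
    rw [e1, e2, Set.ncard_union_eq, Set.ncard_union_eq, hdeg' v hv]
    · rw [Set.disjoint_left]
      rintro w ⟨ha, hb⟩ ⟨hc, hd, he⟩
      tauto
    · rw [Set.disjoint_left]
      rintro w ⟨ha, hb⟩ ⟨hc, hd, he⟩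
      tauto
  by_cases hmt : (K1 ∩ D) = ∅
  · rw [hmt]; simp
  obtain ⟨u0, hu0⟩ := Finset.nonempty_iff_ne_empty.2 hmt
  obtain ⟨hu1, huD⟩ := Finset.mem_inter.1 hu0
  by_cases hsub : K1 ⊆ D
  · -- K1 inside D
    have hsub2 : K2 ⊆ D := by
      obtain ⟨z, hz1, hz2⟩ := hmeet
      intro w hw
      by_contra hwD
      obtain ⟨p⟩ := h2.conn z hz2 w hw
      obtain ⟨s, hs, hs', -, y, hy⟩ := exit_aux hDS h2.le p (hsub hz1) hwD
      have a1 : ((inG C2 D).neighborSet s).ncard ≠ 0 :=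
        (Set.ncard_ne_zero_of_mem (a := y) hy)
      rw [← hdeg s hs hs'] at a1
      obtain ⟨y', hy'⟩ := Set.nonempty_of_ncard_ne_zero a1
      exact hs' (hsub (h1.sup s y' hy'.1))
    rw [Finset.inter_eq_left.2 hsub, Finset.inter_eq_left.2 hsub2, hL1, hL2]
  obtain ⟨w0, hw0, hw0D⟩ := Finset.not_subset.1 hsub
  set K : Finset V := (K1 ∩ D) ∪ (K2 \ D) with hK
  have hHG : CG G H K := by
    have hsup : ∀ u v, H.Adj u v → u ∈ K := by
      intro u v huv
      by_cases hu : u ∈ D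
      · have : v ∈ H.neighborSet u := huv
        rw [nD u hu] at this
        simp [hK, hu, h1.sup u v this]
      · have : (H.neighborSet u).ncard ≠ 0 := Set.ncard_ne_zero_of_mem (a := v) huv
        rw [nO u hu] at this
        obtain ⟨y', hy'⟩ := Set.nonempty_of_ncard_ne_zero this
        simp [hK, hu, h2.sup u y' hy']
    refine ⟨?_, ?_, hsup, ?_⟩
    · intro u v huv
      rcases huv with h | h
      · exact h1.le h.1
      · exact h2.le h.1
    · intro v hv
      by_cases hvD : v ∈ D
      · rw [nD v hvD]
        exact h1.deg v (by simpa [hK, hvD] using hv)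
      · rw [nO v hvD]
        exact h2.deg v (by simpa [hK, hvD] using hv)
    · have toO : ∀ u ∈ K, ∃ s ∈ K2 \ D, H.Reachable u s := by
        intro u hu
        by_cases huD : u ∈ D
        · have huK : u ∈ K1 := by simpa [hK, huD] using hu
          obtain ⟨p⟩ := h1.conn u huK w0 hw0
          obtain ⟨s, hs, hs', hr, y, hy⟩ := exit_aux hDS h1.le p huD hw0D
          refine ⟨s, ?_, hr.mono le_sup_left⟩
          have : s ∈ K := hsup s y (Or.inl hy)
          simpa [hK, hs'] using this
        · exact ⟨u, by simpa [hK, huD] using hu, Reachable.refl _⟩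
      intro u hu v hv
      obtain ⟨s, hs, hus⟩ := toO u hu
      obtain ⟨s', hs', hvs⟩ := toO v hv
      rw [Finset.mem_sdiff] at hs hs'
      obtain ⟨p⟩ := h2.conn s hs.1 s' hs'.1
      exact (hus.trans ((reach_aux hDS h2.le le_sup_right
        (fun a ha b hb hab => (hreach a ha b hb hab).mono le_sup_left) p hs'.2).1 hs.2)).trans
          hvs.symm
  obtain ⟨x, W, hW, hl⟩ := hHG.cycle ⟨u0, by simp [hK, hu1, huD]⟩
  have := hmax x W hW
  rw [hl, hK, Finset.card_union_of_disjoint] at this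
  · have e := Finset.card_inter_add_card_sdiff K2 D
    omega
  · rw [Finset.disjoint_left]
    intro a ha hb
    rw [Finset.mem_inter] at ha
    rw [Finset.mem_sdiff] at hb
    exact hb.2 ha.2

end Swap
section Values

variable {V : Type}

/-- A representative in `S` of the component of `u`. -/
noncomputable def rp (C : SimpleGraph V) (S : Finset V) (u : S) : S :=
  @Function.invFun _ _ ⟨u⟩ (fun v : S => C.connectedComponentMk v.1) (C.connectedComponentMk u.1)

lemma rp_spec (C : SimpleGraph V) (S : Finset V) (u : S) :
    C.connectedComponentMk u.1 = C.connectedComponentMk (rp C S u).1 := by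
  have : Nonempty S := ⟨u⟩
  exact (Function.invFun_eq (f := fun v : S => C.connectedComponentMk v.1) ⟨u, rfl⟩).symm

lemma rp_eq (C : SimpleGraph V) (S : Finset V) (u v : S)
    (h : C.connectedComponentMk u.1 = C.connectedComponentMk v.1) : rp C S u = rp C S v := by
  unfold rp
  rw [h]

/-- The pattern that the cycle `C` leaves on `S`. -/
noncomputable def pat (C : SimpleGraph V) (D S : Finset V) (u : S) : Fin 3 × S :=
  (Fin.ofNat 3 ((inG C D).neighborSet u.1).ncard, rp (inG C D) S u)

lemma in_deg_lt [Fintype V] [DecidableEq V] {G C : SimpleGraph V} {K D : Finset V}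
    (h : CG G C K) (v : V) : ((inG C D).neighborSet v).ncard < 3 := by
  have h1 : ((inG C D).neighborSet v).ncard ≤ (C.neighborSet v).ncard :=
    Set.ncard_le_ncard (fun w hw => hw.1) (Set.toFinite _)
  by_cases hv : v ∈ K
  · rw [h.deg v hv] at h1; omega
  · have : C.neighborSet v = ∅ := by
      ext w
      simp only [mem_neighborSet, Set.mem_empty_iff_false, iff_false]
      exact fun hw => hv (h.sup v w hw)
    rw [this] at h1
    simp at h1
    simp [h1]

lemma swap_pat [Fintype V] [DecidableEq V] {G C1 C2 : SimpleGraph V} {D S K1 K2 : Finset V}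
    (hDS : ∀ u ∈ D, ∀ v, G.Adj u v → v ∈ D ∨ v ∈ S)
    (h1 : CG G C1 K1) (h2 : CG G C2 K2) (L : ℕ) (hL1 : K1.card = L) (hL2 : K2.card = L)
    (hmax : ∀ (y : V) (W : G.Walk y y), W.IsCycle → W.length ≤ L)
    (hmeet : ∃ z ∈ K1, z ∈ K2) (hp : pat C1 D S = pat C2 D S) :
    (K1 ∩ D).card ≤ (K2 ∩ D).card := by
  refine swap hDS h1 h2 L hL1 hL2 hmax hmeet ?_ ?_
  · intro u hu _
    have := congrArg Prod.fst (congrFun hp ⟨u, hu⟩)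
    simp only [pat] at this
    have := congrArg Fin.val this
    simp only [Fin.ofNat] at this
    rwa [Nat.mod_eq_of_lt (in_deg_lt h1 u), Nat.mod_eq_of_lt (in_deg_lt h2 u)] at this
  · intro u hu v hv huv
    have e1 := congrArg Prod.snd (congrFun hp ⟨u, hu⟩)
    have e2 := congrArg Prod.snd (congrFun hp ⟨v, hv⟩)
    simp only [pat] at e1 e2
    have r1 := rp_spec (inG C1 D) S ⟨u, hu⟩
    have r2 := rp_spec (inG C1 D) S ⟨v, hv⟩
    rw [← ConnectedComponent.eq] at huv ⊢
    have e3 := rp_eq (inG C2 D) S ⟨u, hu⟩ ⟨v, hv⟩ huv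
    rw [e1, e3, ← e2] at r1
    exact r1.trans r2.symm

lemma few_values [Fintype V] [DecidableEq V] {ι : Type} [Fintype ι] {G : SimpleGraph V}
    {D S : Finset V} (C : ι → SimpleGraph V) (K : ι → Finset V)
    (hDS : ∀ u ∈ D, ∀ v, G.Adj u v → v ∈ D ∨ v ∈ S)
    (h : ∀ i, CG G (C i) (K i)) (L : ℕ) (hL : ∀ i, (K i).card = L)
    (hmax : ∀ (y : V) (W : G.Walk y y), W.IsCycle → W.length ≤ L)
    (hmeet : ∀ i j, ∃ z ∈ K i, z ∈ K j) :
    (Finset.univ.image fun i => (K i ∩ D).card).card ≤ (3 * S.card) ^ S.card := by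
  classical
  have hc : (Finset.univ : Finset (S → Fin 3 × S)).card = (3 * S.card) ^ S.card := by
    simp
  rw [← hc]
  have hex : ∀ a ∈ (Finset.univ.image fun i => (K i ∩ D).card), ∃ i, (K i ∩ D).card = a := by
    intro a ha
    simpa using ha
  rcases isEmpty_or_nonempty ι with hi | hi
  · simp
  choose! g hg using hex
  apply Finset.card_le_card_of_injOn (fun a => pat (C (g a)) D S) (by simp)
  intro a ha b hb hab
  simp only at hab
  rw [← hg a ha, ← hg b hb]
  exact le_antisymm (swap_pat hDS (h _) (h _) L (hL _) (hL _) hmax (hmeet _ _) hab)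
    (swap_pat hDS (h _) (h _) L (hL _) (hL _) hmax (hmeet _ _) hab.symm)

lemma ivt {G : SimpleGraph V} (f : V → ℕ) (s : ℕ) (hf : ∀ u v, G.Adj u v → f v ≤ f u + s)
    (x : ℕ) {a b : V} (p : G.Walk a b) (ha : f a ≤ x) (hb : x < f b) :
    ∃ c, x < f c ∧ f c ≤ x + s := by
  induction p with
  | nil => omega
  | cons h p ih =>
    rename_i u w z
    by_cases hw : f w ≤ x
    · exact ih hw hb
    · have := hf u w h
      exact ⟨w, by omega, by omega⟩

lemma range_bound [Fintype V] {G : SimpleGraph V} (hG : G.Connected) (f : V → ℕ) (s P : ℕ)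
    (hf : ∀ u v, G.Adj u v → f v ≤ f u + s)
    (hP : (Finset.univ.image f).card ≤ P) (a b : V) : f b ≤ f a + s * P := by
  classical
  by_contra hlt
  push Not at hlt
  obtain ⟨p⟩ := hG.preconnected a b
  have hex : ∀ j : ℕ, j < P → ∃ c, f a + j * s < f c ∧ f c ≤ f a + j * s + s := by
    intro j hj
    apply ivt f s hf _ p (by omega)
    have : j * s ≤ P * s := Nat.mul_le_mul_right _ hj.le
    rw [mul_comm P s] at this
    omega
  have : Nonempty V := ⟨a⟩
  choose! c hc1 hc2 using hex
  have : (Finset.range (P + 1)).card ≤ (Finset.univ.image f).card := by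
    apply Finset.card_le_card_of_injOn (fun j => if j = 0 then f a else f (c (j - 1)))
    · intro j _
      simp only [Finset.coe_image, Finset.coe_univ, Set.image_univ, Set.mem_range]
      split_ifs
      · exact ⟨a, rfl⟩
      · exact ⟨_, rfl⟩
    · have key : ∀ i j, i < j → j < P + 1 → (if i = 0 then f a else f (c (i - 1))) <
          (if j = 0 then f a else f (c (j - 1))) := by
        intro i j hij hj
        rw [if_neg (by omega : j ≠ 0)]
        have h1 := hc1 (j - 1) (by omega)
        split_ifs with h0
        · exact lt_of_le_of_lt (Nat.le_add_right _ _) h1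
        · have h2 := hc2 (i - 1) (by omega)
          have h3 : (i - 1 + 1) * s ≤ (j - 1) * s := Nat.mul_le_mul_right _ (by omega)
          rw [add_mul, one_mul] at h3
          omega
      intro i hi j hj hij
      simp only [Finset.coe_range, Set.mem_Iio] at hi hj
      rcases lt_trichotomy i j with h | h | h
      · have := key i j h hj; simp only at hij; omega
      · exact h
      · have := key j i h hi; simp only at hij; omega
  rw [Finset.card_range] at this
  omega

end Values
section Counting

variable {V : Type}

open Classical in
/-- Open ball. -/
noncomputable def bl [Fintype V] (G : SimpleGraph V) (o : V) (r : ℕ) : Finset V :=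
  Finset.univ.filter fun v => G.dist o v < r

open Classical in
/-- Sphere. -/
noncomputable def sp [Fintype V] (G : SimpleGraph V) (o : V) (r : ℕ) : Finset V :=
  Finset.univ.filter fun v => G.dist o v = r

lemma mem_bl [Fintype V] {G : SimpleGraph V} {o v : V} {r : ℕ} : v ∈ bl G o r ↔ G.dist o v < r := by
  simp [bl]

lemma mem_sp [Fintype V] {G : SimpleGraph V} {o v : V} {r : ℕ} : v ∈ sp G o r ↔ G.dist o v = r := by
  simp [sp]

lemma dist_iso_le {G : SimpleGraph V} (hG : G.Connected) (g : G ≃g G) (u v : V) :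
    G.dist (g u) (g v) ≤ G.dist u v := by
  obtain ⟨p, hp⟩ := hG.exists_walk_length_eq_dist u v
  rw [← hp, ← Walk.length_map (f := g.toHom) (p := p)]
  exact dist_le _

lemma dist_iso {G : SimpleGraph V} (hG : G.Connected) (g : G ≃g G) (u v : V) :
    G.dist (g u) (g v) = G.dist u v := by
  apply le_antisymm (dist_iso_le hG g u v)
  have := dist_iso_le hG g.symm (g u) (g v)
  simpa using this

lemma bl_card [Fintype V] [DecidableEq V] {G : SimpleGraph V} (hG : G.Connected)
    (hv : IsVertexTransitive G) (o o' : V) (r : ℕ) : (bl G o r).card = (bl G o' r).card := by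
  have key : ∀ o o', (bl G o r).card ≤ (bl G o' r).card := by
    intro o o'
    obtain ⟨g, hg⟩ := hv o o'
    apply Finset.card_le_card_of_injOn g
    · intro z hz
      simp only [Finset.mem_coe, mem_bl] at hz ⊢
      rw [← hg, dist_iso hG]; exact hz
    · exact g.injective.injOn
  exact le_antisymm (key _ _) (key _ _)

lemma sp_card [Fintype V] [DecidableEq V] {G : SimpleGraph V} (hG : G.Connected)
    (hv : IsVertexTransitive G) (o o' : V) (r : ℕ) : (sp G o r).card = (sp G o' r).card := by
  have key : ∀ o o', (sp G o r).card ≤ (sp G o' r).card := by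
    intro o o'
    obtain ⟨g, hg⟩ := hv o o'
    apply Finset.card_le_card_of_injOn g
    · intro z hz
      simp only [Finset.mem_coe, mem_sp] at hz ⊢
      rw [← hg, dist_iso hG]; exact hz
    · exact g.injective.injOn
  exact le_antisymm (key _ _) (key _ _)

lemma exists_m [DecidableEq V] {G : SimpleGraph V} [Fintype (G ≃g G)] [Nonempty V]
    (hv : IsVertexTransitive G) :
    ∃ m, 0 < m ∧ ∀ u v, (Finset.univ.filter fun h : G ≃g G => h u = v).card = m := by
  classical
  have key : ∀ u v u' v', (Finset.univ.filter fun h : G ≃g G => h u = v).card ≤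
      (Finset.univ.filter fun h : G ≃g G => h u' = v').card := by
    intro u v u' v'
    obtain ⟨a, ha⟩ := hv u' u
    obtain ⟨b, hb⟩ := hv v v'
    apply Finset.card_le_card_of_injOn (fun h => (a.trans h).trans b)
    · intro h hh
      simp only [Finset.coe_filter, Finset.mem_univ, true_and, Set.mem_ofPred_eq] at hh ⊢
      simp [ha, hh, hb]
    · intro h _ h' _ hhh
      ext z
      have := DFunLike.congr_fun hhh (a.symm z)
      simpa using this
  obtain ⟨o⟩ := ‹Nonempty V›
  refine ⟨(Finset.univ.filter fun h : G ≃g G => h o = o).card, ?_, fun u v =>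
    le_antisymm (key _ _ _ _) (key _ _ _ _)⟩
  apply Finset.card_pos.2
  exact ⟨RelIso.refl _, by simp⟩

lemma cnt_one [DecidableEq V] {G : SimpleGraph V} [Fintype (G ≃g G)] {m : ℕ}
    (hm : ∀ u v, (Finset.univ.filter fun h : G ≃g G => h u = v).card = m) (u : V) (B : Finset V) :
    (Finset.univ.filter fun h : G ≃g G => h u ∈ B).card = B.card * m := by
  classical
  rw [Finset.card_eq_sum_card_fiberwise (f := fun h : G ≃g G => h u) (t := B)]
  · rw [Finset.sum_const_nat]
    intro v hv
    rw [← hm u v]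
    congr 1
    ext h
    simp only [Finset.mem_filter, Finset.mem_univ, true_and]
    constructor
    · exact fun h => h.2
    · exact fun h => ⟨h ▸ hv, h⟩
  · intro h hh
    simpa using hh

lemma cnt_sum [DecidableEq V] {G : SimpleGraph V} [Fintype (G ≃g G)] {m : ℕ}
    (hm : ∀ u v, (Finset.univ.filter fun h : G ≃g G => h u = v).card = m) (A B : Finset V) :
    ∑ h : G ≃g G, (A.filter fun u => h u ∈ B).card = A.card * B.card * m := by
  classical
  simp only [Finset.card_filter]
  rw [Finset.sum_comm]
  simp only [← Finset.card_filter, cnt_one hm]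
  rw [Finset.sum_const, smul_eq_mul, mul_assoc]

lemma card_le_of_hit [Fintype V] [DecidableEq V] {G : SimpleGraph V} [Nonempty V]
    (hv : IsVertexTransitive G) (A T : Finset V) (hit : ∀ h : G ≃g G, ∃ u ∈ A, h u ∈ T) :
    Fintype.card V ≤ A.card * T.card := by
  classical
  have : Finite (G ≃g G) := DFunLike.finite _
  have : Fintype (G ≃g G) := Fintype.ofFinite _
  obtain ⟨m, hm0, hm⟩ := exists_m hv
  obtain ⟨o⟩ := ‹Nonempty V›
  have h1 := cnt_sum hm A T
  have h2 := cnt_one hm o Finset.univ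
  have h3 : ∑ h : G ≃g G, 1 ≤ ∑ h : G ≃g G, (A.filter fun u => h u ∈ T).card := by
    apply Finset.sum_le_sum
    intro h _
    obtain ⟨u, hu, hu'⟩ := hit h
    exact Finset.card_pos.2 ⟨u, by simp [hu, hu']⟩
  simp at h2 h3
  rw [h1, h2] at h3
  exact Nat.le_of_mul_le_mul_right h3 hm0

lemma isoper [Fintype V] [DecidableEq V] {G : SimpleGraph V} (hG : G.Connected)
    (hv : IsVertexTransitive G) (A T : Finset V)
    (hT : ∀ a ∈ A, ∀ b, b ∉ A → ∀ p : G.Walk a b, ∃ w ∈ p.support, w ∈ T) (o : V) (r : ℕ) :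
    A.card * (bl G o r).card ≤ A.card * A.card + (bl G o r).card * r * T.card := by
  classical
  have : Finite (G ≃g G) := DFunLike.finite _
  have : Fintype (G ≃g G) := Fintype.ofFinite _
  have : Nonempty V := ⟨o⟩
  obtain ⟨m, hm0, hm⟩ := exists_m hv
  choose P hP using fun z => hG.exists_walk_length_eq_dist o z
  set β := (bl G o r).card with hβ
  have hone : ∀ h : G ≃g G, h o ∈ A → β ≤ A.card +
      ∑ z ∈ bl G o r, ((P z).support.toFinset.filter fun w => h w ∈ T).card := by
    intro h ho
    rw [hβ, ← Finset.card_filter_add_card_filter_not (s := bl G o r) (fun z => h z ∈ A)]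
    apply add_le_add
    · apply Finset.card_le_card_of_injOn h
      · intro z hz
        simp only [Finset.coe_filter, Set.mem_ofPred_eq] at hz
        exact hz.2
      · exact h.injective.injOn
    · rw [Finset.card_filter]
      apply Finset.sum_le_sum
      intro z _
      by_cases hz : h z ∈ A
      · simp [hz]
      · rw [if_pos hz]
        obtain ⟨w, hw, hwT⟩ := hT (h o) ho (h z) hz ((P z).map h.toHom)
        rw [Walk.support_map, List.mem_map] at hw
        obtain ⟨w', hw', rfl⟩ := hw
        refine Finset.card_pos.2 ⟨w', ?_⟩
        rw [Finset.mem_filter, List.mem_toFinset]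
        exact ⟨hw', hwT⟩
  have h1 : ∑ h ∈ Finset.univ.filter (fun h : G ≃g G => h o ∈ A), β ≤
      ∑ h ∈ Finset.univ.filter (fun h : G ≃g G => h o ∈ A), A.card +
      ∑ h : G ≃g G, ∑ z ∈ bl G o r, ((P z).support.toFinset.filter fun w => h w ∈ T).card := by
    calc _ ≤ ∑ h ∈ Finset.univ.filter (fun h : G ≃g G => h o ∈ A), (A.card +
        ∑ z ∈ bl G o r, ((P z).support.toFinset.filter fun w => h w ∈ T).card) :=
          Finset.sum_le_sum fun h hh => hone h (by simpa using hh)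
      _ ≤ _ := by
        rw [Finset.sum_add_distrib]
        exact Nat.add_le_add_left (Finset.sum_le_sum_of_subset (Finset.filter_subset _ _)) _
  rw [Finset.sum_const, Finset.sum_const, cnt_one hm, Finset.sum_comm] at h1
  simp only [cnt_sum hm, smul_eq_mul] at h1
  have h2 : ∑ z ∈ bl G o r, (P z).support.toFinset.card * T.card * m ≤ ∑ z ∈ bl G o r, r * T.card * m := by
    apply Finset.sum_le_sum
    intro z hz
    have : (P z).support.toFinset.card ≤ r := by
      refine (List.toFinset_card_le _).trans ?_
      rw [Walk.length_support, hP]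
      exact mem_bl.1 hz
    gcongr
  rw [Finset.sum_const, smul_eq_mul, ← hβ] at h2
  apply Nat.le_of_mul_le_mul_right _ hm0
  nlinarith

end Counting
section Assembly

variable {V : Type}

lemma exists_sep [Fintype V] [DecidableEq V] {G : SimpleGraph V} {x y : V} {X : G.Walk x x}
    {Y : G.Walk y y} (hX : IsLongestCycle G X) (hY : IsLongestCycle G Y) (k : ℕ)
    (hk : (X.support.toFinset ∩ Y.support.toFinset).card = k) :
    ∃ T : Finset V, Separates G X.support.toFinset Y.support.toFinset T ∧
      T.card ≤ (k + 1) ^ 2 + k := by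
  by_contra hcon
  push Not at hcon
  exact exchange hX hY k hk (menger _ _ G _ _ rfl fun T hT => hcon T hT)

lemma IsLongestCycle.mapIso {G : SimpleGraph V} {x : V} {X : G.Walk x x}
    (hX : IsLongestCycle G X) (h : G ≃g G) : IsLongestCycle G (X.map h.toHom) := by
  refine ⟨hX.1.map h.injective, fun y W hW => ?_⟩
  rw [Walk.length_map]
  exact hX.2 y W hW

lemma longest_length {G : SimpleGraph V} {x y : V} {X : G.Walk x x} {Y : G.Walk y y}
    (hX : IsLongestCycle G X) (hY : IsLongestCycle G Y) : X.length = Y.length :=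
  le_antisymm (hY.2 _ _ hX.1) (hX.2 _ _ hY.1)

lemma meet [Fintype V] [DecidableEq V] {G : SimpleGraph V} (hG : G.Connected)
    (hv : IsVertexTransitive G) {x y : V} {X : G.Walk x x}
    {Y : G.Walk y y} (hX : IsLongestCycle G X) (hY : IsLongestCycle G Y) :
    ∃ z ∈ X.support, z ∈ Y.support := by
  by_contra hcon
  push Not at hcon
  have h0 : (X.support.toFinset ∩ Y.support.toFinset).card = 0 := by
    rw [Finset.card_eq_zero]
    ext z
    simp only [Finset.mem_inter, List.mem_toFinset, Finset.notMem_empty, iff_false, not_and]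
    exact hcon z
  obtain ⟨T, hT, hTc⟩ := exists_sep hX hY 0 h0
  have : Nonempty V := ⟨x⟩
  obtain ⟨v, hTv⟩ := Finset.card_le_one_iff_subset_singleton.1 (by simpa using hTc)
  have hex : ∀ (x : V) (X : G.Walk x x), X.IsCycle → ∃ a ∈ X.support, a ≠ v := by
    intro x X hX
    by_contra hc
    push Not at hc
    have h1 := cycle_card hX
    have h2 := hX.three_le_length
    have h3 : X.support.toFinset.card ≤ ({v} : Finset V).card := by
      apply Finset.card_le_card
      intro a ha
      simpa using hc a (by simpa using ha)
    simp at h3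
    omega
  obtain ⟨a, ha, hav⟩ := hex x X hX.1
  obtain ⟨b, hb, hbv⟩ := hex y Y hY.1
  obtain ⟨v0, hv0⟩ := hG.exists_preconnected_induce_compl_singleton_of_finite
  obtain ⟨g, hg⟩ := hv v v0
  obtain ⟨p⟩ := hv0 ⟨g a, by simpa [← hg] using hav⟩ ⟨g b, by simpa [← hg] using hbv⟩
  have k1 : ∃ q : G.Walk (g a) (g b), ∀ w ∈ q.support, w ≠ v0 := by
    have k0 : ∀ (a b : ({v0}ᶜ : Set V)) (p : (G.induce {v0}ᶜ).Walk a b),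
        ∃ q : G.Walk a.1 b.1, ∀ w ∈ q.support, w ≠ v0 := by
      intro a b p
      induction p with
      | nil => rename_i u; exact ⟨Walk.nil, fun w hw => by
          rw [Walk.support_nil, List.mem_singleton] at hw; rw [hw]; exact u.2⟩
      | cons h p ih =>
        rename_i u w z
        obtain ⟨q, hq⟩ := ih
        refine ⟨Walk.cons (induce_adj.1 h) q, fun w' hw' => ?_⟩
        rw [Walk.support_cons, List.mem_cons] at hw'
        rcases hw' with rfl | hw'
        · exact u.2
        · exact hq w' hw'
    exact k0 _ _ p
  obtain ⟨q, hq⟩ := k1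
  have k2 : ∃ q : G.Walk (g.symm (g a)) (g.symm (g b)), ∀ w ∈ q.support, w ≠ v := by
    refine ⟨q.map g.symm.toHom, fun w hw => ?_⟩
    rw [Walk.support_map, List.mem_map] at hw
    obtain ⟨z, hz, rfl⟩ := hw
    rintro rfl
    exact hq z hz (by rw [← hg]; exact (g.apply_symm_apply z).symm)
  rw [g.symm_apply_apply, g.symm_apply_apply] at k2
  obtain ⟨q', hq'⟩ := k2
  obtain ⟨w, hw, hwT⟩ := hT a (by simpa using ha) b (by simpa using hb) q'
  exact hq' w hw (by simpa using hTv hwT)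

lemma geod [Fintype V] {G : SimpleGraph V} (hG : G.Connected) {o z : V} {r : ℕ}
    (hz : r ≤ G.dist o z) (j : ℕ) (hj : j ≤ r) : ∃ c, G.dist o c = j := by
  rcases Nat.eq_zero_or_pos j with rfl | hj0
  · exact ⟨o, by simp⟩
  obtain ⟨p⟩ := hG.preconnected o z
  obtain ⟨c, h1, h2⟩ := ivt (G := G) (fun v => G.dist o v) 1 (by
    intro u v huv
    have := hG.dist_triangle (u := o) (v := u) (w := v)
    rw [dist_eq_one_iff_adj.2 huv] at this
    exact this) (j - 1) p (by simp) (by omega)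
  exact ⟨c, by omega⟩

lemma le_bl_card [Fintype V] {G : SimpleGraph V} (hG : G.Connected) {o z : V} {r : ℕ}
    (hz : r ≤ G.dist o z) : r ≤ (bl G o r).card := by
  have : Nonempty V := ⟨o⟩
  choose! c hc using geod hG hz
  have := Finset.card_le_card_of_injOn (s := Finset.range r) (t := bl G o r) c (by
    intro j hj
    simp only [Finset.coe_range, Set.mem_Iio] at hj
    simp only [Finset.mem_coe, mem_bl, hc j hj.le]
    exact hj) (by
    intro i hi j hj hij
    simp only [Finset.coe_range, Set.mem_Iio] at hi hj
    rw [← hc i hi.le, ← hc j hj.le, hij])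
  simpa using this

lemma pack [Fintype V] [DecidableEq V] {G : SimpleGraph V} (hG : G.Connected)
    (hv : IsVertexTransitive G) {o z : V} {r : ℕ}
    (hz : r ≤ G.dist o z) (t M : ℕ) (hM : (2 * t + 1) * M ≤ r) :
    (t + 1) * (bl G o M).card ≤ (bl G o r).card ∧ ∀ T : Finset V, T.card ≤ t →
      1 ≤ M → ∃ c, Disjoint (bl G c M) T := by
  have : Nonempty V := ⟨o⟩
  choose! c hc using geod hG hz
  have hle : ∀ i ∈ Finset.range (t + 1), 2 * M * i ≤ r := by
    intro i hi
    rw [Finset.mem_range] at hi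
    have : 2 * M * i ≤ 2 * M * t := Nat.mul_le_mul_left _ (by omega)
    nlinarith
  have hdisj : ∀ i ∈ Finset.range (t + 1), ∀ j ∈ Finset.range (t + 1), i < j →
      Disjoint (bl G (c (2 * M * i)) M) (bl G (c (2 * M * j)) M) := by
    intro i hi j hj hij
    rw [Finset.disjoint_left]
    intro w hw hw'
    rw [mem_bl] at hw hw'
    have d1 := hG.dist_triangle (u := o) (v := c (2 * M * i)) (w := c (2 * M * j))
    have d2 := hG.dist_triangle (u := c (2 * M * i)) (v := w) (w := c (2 * M * j))
    rw [hc _ (hle i hi), hc _ (hle j hj)] at d1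
    rw [dist_comm (u := w)] at d2
    have : 2 * M * (i + 1) ≤ 2 * M * j := Nat.mul_le_mul_left _ hij
    rw [mul_add] at this
    omega
  have hdisj' : ∀ i ∈ Finset.range (t + 1), ∀ j ∈ Finset.range (t + 1), i ≠ j →
      Disjoint (bl G (c (2 * M * i)) M) (bl G (c (2 * M * j)) M) := by
    intro i hi j hj hij
    rcases lt_or_gt_of_ne hij with h | h
    · exact hdisj i hi j hj h
    · exact (hdisj j hj i hi h).symm
  constructor
  · have h1 := Finset.card_biUnion (s := Finset.range (t + 1))
      (t := fun i => bl G (c (2 * M * i)) M) hdisj'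
    rw [Finset.sum_congr rfl (fun i _ => bl_card hG hv (c (2 * M * i)) o M), Finset.sum_const,
      Finset.card_range, smul_eq_mul] at h1
    rw [← h1]
    apply Finset.card_le_card
    intro w hw
    rw [Finset.mem_biUnion] at hw
    obtain ⟨i, hi, hw⟩ := hw
    rw [mem_bl] at hw ⊢
    have d1 := hG.dist_triangle (u := o) (v := c (2 * M * i)) (w := w)
    rw [hc _ (hle i hi)] at d1
    rw [Finset.mem_range] at hi
    have : 2 * M * i ≤ 2 * M * t := Nat.mul_le_mul_left _ (by omega)
    nlinarith
  · intro T hT _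
    by_contra hcon
    push Not at hcon
    have hex : ∀ i ∈ Finset.range (t + 1), ∃ w, w ∈ bl G (c (2 * M * i)) M ∧ w ∈ T := by
      intro i _
      have := hcon (c (2 * M * i))
      rwa [Finset.not_disjoint_iff] at this
    have : Nonempty V := ⟨o⟩
    choose! w hw1 hw2 using hex
    have := Finset.card_le_card_of_injOn (s := Finset.range (t + 1)) (t := T) w hw2 (by
      intro i hi j hj hij
      by_contra hne
      exact Finset.disjoint_left.1 (hdisj' i hi j hj hne) (hw1 i hi) (hij ▸ hw1 j hj))
    rw [Finset.card_range] at this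
    omega

lemma thin [Fintype V] [DecidableEq V] {G : SimpleGraph V} (o : V) (μ : ℕ) (hμ : 1 ≤ μ) :
    ∃ q, μ ≤ q ∧ q < 2 * μ ∧ (sp G o q).card * μ ≤ (bl G o (2 * μ)).card := by
  by_contra hcon
  push Not at hcon
  have h1 := Finset.card_biUnion (s := Finset.Ico μ (2 * μ)) (t := fun q => sp G o q) (by
    intro i _ j _ hij
    refine Finset.disjoint_left.2 ?_
    intro w hw hw'
    simp only [mem_sp] at hw hw'
    omega)
  have h2 : ((Finset.Ico μ (2 * μ)).biUnion fun q => sp G o q).card ≤ (bl G o (2 * μ)).card := by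
    apply Finset.card_le_card
    intro w hw
    rw [Finset.mem_biUnion] at hw
    obtain ⟨i, hi, hw⟩ := hw
    rw [Finset.mem_Ico] at hi
    rw [mem_sp] at hw
    rw [mem_bl]
    omega
  have h3 : ∑ q ∈ Finset.Ico μ (2 * μ), (bl G o (2 * μ)).card <
      ∑ q ∈ Finset.Ico μ (2 * μ), (sp G o q).card * μ := by
    apply Finset.sum_lt_sum_of_nonempty
    · rw [Finset.nonempty_Ico]; omega
    · intro q hq
      rw [Finset.mem_Ico] at hq
      exact hcon q hq.1 hq.2
  rw [← Finset.sum_mul, ← h1, Finset.sum_const, smul_eq_mul, Nat.card_Ico] at h3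
  have : 2 * μ - μ = μ := by omega
  rw [this, mul_comm] at h3
  have := Nat.mul_le_mul_right μ h2
  omega

lemma meets_all [Fintype V] [DecidableEq V] {G : SimpleGraph V} (hG : G.Connected)
    (hv : IsVertexTransitive G) {x : V} {X : G.Walk x x} (hX : IsLongestCycle G X) (o : V)
    (q s t : ℕ) (hs : (sp G o q).card = s) (hn : Fintype.card V ≤ X.length * t)
    (hβ : t * (s * (3 * s) ^ s) < (bl G o q).card) (v0 : V) :
    ∃ z ∈ X.support, z ∈ bl G v0 q := by
  by_contra hcon
  push Not at hcon
  set f : V → ℕ := fun v => (X.support.toFinset ∩ bl G v q).card with hf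
  have hf0 : f v0 = 0 := by
    simp only [hf, Finset.card_eq_zero]
    ext z
    simp only [Finset.mem_inter, List.mem_toFinset, Finset.notMem_empty, iff_false, not_and]
    exact hcon z
  choose g hg using fun v => hv v o
  have hfv : ∀ v, f v = ((X.map (g v).toHom).support.toFinset ∩ bl G o q).card := by
    intro v
    simp only [hf]
    rw [← Finset.card_image_of_injective _ (g v).injective]
    congr 1
    ext w
    simp only [Finset.mem_image, Finset.mem_inter, List.mem_toFinset, Walk.support_map,
      List.mem_map, mem_bl]
    constructor
    · rintro ⟨a, ⟨h1, h2⟩, rfl⟩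
      refine ⟨⟨a, h1, rfl⟩, ?_⟩
      rw [← hg v, dist_iso hG]; exact h2
    · rintro ⟨⟨a, h1, rfl⟩, h2⟩
      refine ⟨a, ⟨h1, ?_⟩, rfl⟩
      rw [← hg v] at h2
      rw [← dist_iso hG (g v)]; exact h2
  have hval : (Finset.univ.image f).card ≤ (3 * s) ^ s := by
    rw [← hs]
    have := few_values (G := G) (D := bl G o q) (S := sp G o q)
      (fun v => (X.map (g v).toHom).toSubgraph.spanningCoe)
      (fun v => (X.map (g v).toHom).support.toFinset) (by
        intro u hu w huw
        rw [mem_bl] at hu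
        rw [mem_bl, mem_sp]
        have := hG.dist_triangle (u := o) (v := u) (w := w)
        rw [dist_eq_one_iff_adj.2 huw] at this
        omega) (fun v => CG.of_cycle (hX.mapIso (g v)).1) X.length
      (fun v => by rw [cycle_card (hX.mapIso (g v)).1, Walk.length_map]) hX.2
      (fun u w => by
        obtain ⟨z, h1, h2⟩ := meet hG hv (hX.mapIso (g u)) (hX.mapIso (g w))
        exact ⟨z, by simpa using h1, by simpa using h2⟩)
    refine le_trans (le_of_eq ?_) this
    congr 2
    funext v
    exact hfv v
  have hadj : ∀ u v, G.Adj u v → f v ≤ f u + s := by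
    intro u v huv
    rw [← hs, sp_card hG hv o u q]
    refine le_trans (Finset.card_le_card ?_) (Finset.card_union_le _ _)
    intro w hw
    simp only [Finset.mem_inter, Finset.mem_union, mem_bl, mem_sp] at hw ⊢
    have := hG.dist_triangle (u := u) (v := v) (w := w)
    rw [dist_eq_one_iff_adj.2 huv] at this
    rcases lt_or_ge (G.dist u w) q with h | h
    · exact Or.inl ⟨hw.1, h⟩
    · right; omega
  have hb : ∀ v, f v ≤ s * (3 * s) ^ s := by
    intro v
    have := range_bound hG f s _ hadj hval v0 v
    omega
  have hsum : ∑ v, f v = X.length * (bl G o q).card := by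
    have e : ∀ v, f v = ∑ a ∈ X.support.toFinset, if v ∈ bl G a q then 1 else 0 := by
      intro v
      simp only [hf]
      rw [← Finset.card_filter]
      congr 1
      ext a
      simp only [Finset.mem_inter, Finset.mem_filter, mem_bl, dist_comm (u := v)]
    simp only [e]
    rw [Finset.sum_comm, ← cycle_card hX.1]
    have : ∀ a ∈ X.support.toFinset, (∑ v, if v ∈ bl G a q then 1 else 0) = (bl G o q).card := by
      intro a _
      rw [← Finset.card_filter, bl_card hG hv o a q]
      congr 1
      ext; simp
    rw [Finset.sum_congr rfl this, Finset.sum_const, smul_eq_mul]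
  have hsum2 : ∑ v, f v ≤ Fintype.card V * (s * (3 * s) ^ s) := by
    refine (Finset.sum_le_sum fun v _ => hb v).trans ?_
    simp
  rw [hsum] at hsum2
  have h3 : X.length * (bl G o q).card ≤ X.length * (t * (s * (3 * s) ^ s)) := by
    rw [← mul_assoc X.length t]
    exact hsum2.trans (Nat.mul_le_mul_right _ hn)
  have := Nat.le_of_mul_le_mul_left h3 (by have := hX.1.three_le_length; omega)
  omega

lemma ball_walk [Fintype V] [DecidableEq V] {G : SimpleGraph V} (hG : G.Connected) {c z : V} {q : ℕ}
    (hz : z ∈ bl G c q) : ∃ p : G.Walk c z, ∀ w ∈ p.support, w ∈ bl G c q := by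
  obtain ⟨p, hp⟩ := hG.exists_walk_length_eq_dist c z
  refine ⟨p, fun w hw => ?_⟩
  rw [mem_bl] at hz ⊢
  have h1 := dist_le (p.takeUntil w hw)
  have h2 := p.length_takeUntil_le_length hw
  omega

open Classical in
/-- The side of `T` containing `A`. -/
noncomputable def side [Fintype V] (G : SimpleGraph V) (A T : Finset V) : Finset V :=
  Finset.univ.filter fun v => ∃ a ∈ A, ∃ p : G.Walk a v, ∀ w ∈ p.support, w ∉ T

lemma side_cross [Fintype V] {G : SimpleGraph V} (A T : Finset V) :
    ∀ a ∈ side G A T, ∀ b, b ∉ side G A T → ∀ p : G.Walk a b, ∃ w ∈ p.support, w ∈ T := by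
  intro a ha b hb p
  by_contra hcon
  push Not at hcon
  apply hb
  simp only [side, Finset.mem_filter, Finset.mem_univ, true_and] at ha ⊢
  obtain ⟨a', ha', p', hp'⟩ := ha
  refine ⟨a', ha', p'.append p, fun w hw => ?_⟩
  rw [Walk.mem_support_append_iff] at hw
  rcases hw with hw | hw
  · exact hp' w hw
  · exact hcon w hw

lemma side_card [Fintype V] [DecidableEq V] {G : SimpleGraph V} (A T : Finset V) :
    A.card ≤ (side G A T).card + T.card := by
  refine le_trans (Finset.card_le_card ?_) (Finset.card_union_le _ _)
  intro a ha
  rw [Finset.mem_union]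
  by_cases haT : a ∈ T
  · exact Or.inr haT
  · left
    simp only [side, Finset.mem_filter, Finset.mem_univ, true_and]
    exact ⟨a, ha, Walk.nil, by simpa using haT⟩

lemma side_disj [Fintype V] {G : SimpleGraph V} (A B T : Finset V) (h : Separates G A B T) :
    Disjoint (side G A T) (side G B T) := by
  rw [Finset.disjoint_left]
  intro v h1 h2
  simp only [side, Finset.mem_filter, Finset.mem_univ, true_and] at h1 h2
  obtain ⟨a, ha, p, hp⟩ := h1
  obtain ⟨b, hb, p', hp'⟩ := h2
  obtain ⟨w, hw, hwT⟩ := h a ha b hb (p.append p'.reverse)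
  rw [Walk.mem_support_append_iff] at hw
  rcases hw with hw | hw
  · exact hp w hw hwT
  · exact hp' w (by simpa using hw) hwT

end Assembly
section Core

variable {V : Type}

lemma core [Fintype V] [DecidableEq V] {G : SimpleGraph V} (hG : G.Connected)
    (hv : IsVertexTransitive G) {x y : V} {X : G.Walk x x} {Y : G.Walk y y}
    (hX : IsLongestCycle G X) (hY : IsLongestCycle G Y) (T : Finset V) (t : ℕ) (ht : 1 ≤ t)
    (hTt : T.card ≤ t) (hT : Separates G X.support.toFinset Y.support.toFinset T)
    (hAB : (side G X.support.toFinset T).card ≤ (side G Y.support.toFinset T).card) :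
    Fintype.card V ≤ t * (4 * t * (2 * t + 1) *
      (t * (16 * (2 * t + 1) * (3 * (16 * (2 * t + 1))) ^ (16 * (2 * t + 1))) + 1) + t) := by
  have : Nonempty V := ⟨x⟩
  set L := X.length with hL
  -- every image of X hits T
  have hn : Fintype.card V ≤ L * t := by
    have h1 : Fintype.card V ≤ X.support.toFinset.card * T.card := by
      apply card_le_of_hit hv
      intro h
      obtain ⟨z, hz1, hz2⟩ := meet hG hv (hX.mapIso h) hX
      obtain ⟨z', hz1', hz2'⟩ := meet hG hv (hX.mapIso h) hY
      have hc := CG.of_cycle (hX.mapIso h).1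
      have hcc := (X.map h.toHom).toSubgraph_connected
      -- walk inside the image of X
      have hw : ∃ p : G.Walk z z', ∀ w ∈ p.support, w ∈ (X.map h.toHom).support := by
        refine ⟨((X.map h.toHom).takeUntil z hz1).reverse.append
          ((X.map h.toHom).takeUntil z' hz1'), fun w hw => ?_⟩
        rw [Walk.mem_support_append_iff, Walk.support_reverse, List.mem_reverse] at hw
        rcases hw with hw | hw
        · exact Walk.support_takeUntil_subset_support _ _ hw
        · exact Walk.support_takeUntil_subset_support _ _ hw
      obtain ⟨p, hp⟩ := hw
      obtain ⟨w, hw, hwT⟩ := hT z (by simpa using hz2) z' (by simpa using hz2') p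
      have := hp w hw
      rw [Walk.support_map, List.mem_map] at this
      obtain ⟨u, hu, rfl⟩ := this
      exact ⟨u, by simpa using hu, hwT⟩
    rw [cycle_card hX.1] at h1
    exact h1.trans (Nat.mul_le_mul_left _ hTt)
  set A := side G X.support.toFinset T with hA
  have hLA : L ≤ A.card + t := by
    have h : X.support.toFinset.card ≤ A.card + T.card := by
      have := side_card (G := G) X.support.toFinset T
      omega
    rw [cycle_card hX.1] at h
    omega
  have h2A : 2 * A.card ≤ Fintype.card V := by
    have h : (A ∪ side G Y.support.toFinset T).card
        = A.card + (side G Y.support.toFinset T).card :=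
      Finset.card_union_of_disjoint (side_disj _ _ _ hT)
    have h2 := Finset.card_le_univ (A ∪ side G Y.support.toFinset T)
    omega
  set a := A.card with ha
  set r := (a - 1) / (2 * t) with hr
  have har : a ≤ 2 * t * (r + 1) := by
    have := Nat.lt_mul_div_succ (a - 1) (show 0 < 2 * t by omega)
    rw [← hr] at this
    omega
  set μ := r / (2 * (2 * t + 1)) with hμ
  have hrμ : r + 1 ≤ 2 * (2 * t + 1) * (μ + 1) := by
    have := Nat.lt_mul_div_succ r (show 0 < 2 * (2 * t + 1) by omega)
    rw [← hμ] at this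
    omega
  have hμr : (2 * t + 1) * (2 * μ) ≤ r := by
    have := Nat.div_mul_le_self r (2 * (2 * t + 1))
    rw [← hμ] at this
    nlinarith
  have hfin : ∀ Q, μ ≤ Q → Fintype.card V ≤ t * (4 * t * (2 * t + 1) * (Q + 1) + t) := by
    intro Q hQ
    calc Fintype.card V ≤ L * t := hn
      _ ≤ (a + t) * t := Nat.mul_le_mul_right _ hLA
      _ = t * (a + t) := mul_comm _ _
      _ ≤ t * (4 * t * (2 * t + 1) * (Q + 1) + t) := by
        apply Nat.mul_le_mul_left
        apply Nat.add_le_add_right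
        calc a ≤ 2 * t * (r + 1) := har
          _ ≤ 2 * t * (2 * (2 * t + 1) * (μ + 1)) := Nat.mul_le_mul_left _ hrμ
          _ = 4 * t * (2 * t + 1) * (μ + 1) := by ring
          _ ≤ _ := Nat.mul_le_mul_left _ (by omega)
  apply hfin
  by_contra hbig
  push Not at hbig
  have hμ1 : 1 ≤ μ := by omega
  have hr1 : 1 ≤ r := by
    by_contra h
    have : r = 0 := by omega
    rw [this] at hμr
    nlinarith
  have hra : 2 * t * r < a := by
    have h1 := Nat.div_mul_le_self (a - 1) (2 * t)
    rw [← hr] at h1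
    have : 1 ≤ a := by
      by_contra h
      have : a = 0 := by omega
      rw [this] at hr
      simp at hr
      omega
    have e : r * (2 * t) = 2 * t * r := by ring
    rw [e] at h1
    omega
  have hiso := isoper hG hv A T (side_cross _ _) x r
  set β := (bl G x r).card with hβ
  have hβ2 : β < 2 * a := by
    by_contra hcon
    push Not at hcon
    have h1 : β * r * T.card ≤ β * r * t := Nat.mul_le_mul_left _ hTt
    have h2 : β * (2 * t * r) < β * a := Nat.mul_lt_mul_of_pos_left hra (by omega)
    have h3 : 2 * a * a ≤ β * a := Nat.mul_le_mul_right _ hcon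
    nlinarith
  have hfar : ∃ z, r ≤ G.dist x z := by
    by_contra hcon
    push Not at hcon
    have : bl G x r = Finset.univ := by
      ext z; simp [mem_bl, hcon z]
    rw [hβ, this, Finset.card_univ] at hβ2
    omega
  obtain ⟨z, hz⟩ := hfar
  obtain ⟨hp1, hp2⟩ := pack hG hv hz t (2 * μ) hμr
  obtain ⟨c, hc⟩ := hp2 T hTt (by omega)
  have hb2 : (bl G x (2 * μ)).card < 16 * (2 * t + 1) * μ + 1 := by
    have h1 : (t + 1) * (bl G x (2 * μ)).card < (t + 1) * (4 * (r + 1)) := by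
      calc _ ≤ β := hp1
        _ < 2 * a := hβ2
        _ ≤ 2 * (2 * t * (r + 1)) := Nat.mul_le_mul_left _ har
        _ = t * (4 * (r + 1)) := by ring
        _ ≤ _ := Nat.mul_le_mul_right _ (by omega)
    have h2 := Nat.lt_of_mul_lt_mul_left h1
    have h3 : 4 * (r + 1) ≤ 4 * (2 * (2 * t + 1) * (μ + 1)) := Nat.mul_le_mul_left _ hrμ
    have h4 : 4 * (2 * (2 * t + 1) * (μ + 1)) ≤ 4 * (2 * (2 * t + 1) * (2 * μ)) := by
      gcongr; omega
    have h5 : 4 * (2 * (2 * t + 1) * (2 * μ)) = 16 * (2 * t + 1) * μ := by ring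
    omega
  obtain ⟨q, hq1, hq2, hq3⟩ := thin (G := G) x μ hμ1
  set s := (sp G x q).card with hs
  have hs16 : s ≤ 16 * (2 * t + 1) := by
    have : s * μ ≤ 16 * (2 * t + 1) * μ := by omega
    exact Nat.le_of_mul_le_mul_right this hμ1
  have hβq : t * (s * (3 * s) ^ s) < (bl G x q).card := by
    have h1 : q ≤ (bl G x q).card := le_bl_card hG (z := z) (by
      have : 2 * μ ≤ (2 * t + 1) * (2 * μ) := Nat.le_mul_of_pos_left _ (by omega)
      omega)
    have h2 : t * (s * (3 * s) ^ s) ≤ t * (16 * (2 * t + 1) *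
        (3 * (16 * (2 * t + 1))) ^ (16 * (2 * t + 1))) := by
      apply Nat.mul_le_mul_left
      apply Nat.mul_le_mul hs16
      calc (3 * s) ^ s ≤ (3 * (16 * (2 * t + 1))) ^ s :=
            Nat.pow_le_pow_left (Nat.mul_le_mul_left _ hs16) _
        _ ≤ _ := Nat.pow_le_pow_right (by omega) hs16
    omega
  obtain ⟨z1, hz1, hz1'⟩ := meets_all hG hv hX x q s t hs.symm hn hβq c
  obtain ⟨z2, hz2, hz2'⟩ := meets_all hG hv hY x q s t hs.symm
    (by rw [← longest_length hX hY]; exact hn) hβq c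
  obtain ⟨p1, hp1⟩ := ball_walk hG hz1'
  obtain ⟨p2, hp2⟩ := ball_walk hG hz2'
  obtain ⟨w, hw, hwT⟩ := hT z1 (by simpa using hz1) z2 (by simpa using hz2)
    (p1.reverse.append p2)
  have hwb : w ∈ bl G c q := by
    rw [Walk.mem_support_append_iff, Walk.support_reverse, List.mem_reverse] at hw
    rcases hw with hw | hw
    · exact hp1 w hw
    · exact hp2 w hw
  refine Finset.disjoint_left.1 hc ?_ hwT
  rw [mem_bl] at hwb ⊢
  omega

lemma core_bound [Fintype V] [DecidableEq V] {G : SimpleGraph V} (hG : G.Connected)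
    (hv : IsVertexTransitive G) {x y : V} {X : G.Walk x x} {Y : G.Walk y y}
    (hX : IsLongestCycle G X) (hY : IsLongestCycle G Y) (k t : ℕ)
    (hk : (X.support.toFinset ∩ Y.support.toFinset).card = k) (ht : t = (k + 1) ^ 2 + k) :
    Fintype.card V ≤ t * (4 * t * (2 * t + 1) *
      (t * (16 * (2 * t + 1) * (3 * (16 * (2 * t + 1))) ^ (16 * (2 * t + 1))) + 1) + t) := by
  obtain ⟨T, hT, hTt⟩ := exists_sep hX hY k hk
  rw [← ht] at hTt
  have ht1 : 1 ≤ t := by rw [ht]; nlinarith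
  rcases le_total (side G X.support.toFinset T).card (side G Y.support.toFinset T).card with h | h
  · exact core hG hv hX hY T t ht1 hTt hT h
  · exact core hG hv hY hX T t ht1 hTt hT.symm h

lemma numer (k t n : ℕ) (hk : 1 ≤ k) (ht : t = (k + 1) ^ 2 + k)
    (hn : n ≤ t * (4 * t * (2 * t + 1) *
      (t * (16 * (2 * t + 1) * (3 * (16 * (2 * t + 1))) ^ (16 * (2 * t + 1))) + 1) + t))
    (hn1 : 1 ≤ n) :
    Real.log n ≤ 2385 * (k : ℝ) ^ 3 := by
  have ht1 : 1 ≤ t := by rw [ht]; nlinarith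
  have ht5 : t ≤ 5 * k ^ 2 := by rw [ht]; nlinarith
  set P := (144 * t) ^ (48 * t) with hP
  have hP1 : 1 ≤ P := Nat.one_le_pow _ _ (by omega)
  have hpow : (3 * (16 * (2 * t + 1))) ^ (16 * (2 * t + 1)) ≤ P := by
    calc _ ≤ (144 * t) ^ (16 * (2 * t + 1)) := Nat.pow_le_pow_left (by omega) _
      _ ≤ _ := Nat.pow_le_pow_right (by omega) (by omega)
  have h1 : n ≤ (144 * t) ^ 5 * P := by
    calc n ≤ _ := hn
      _ ≤ t * (4 * t * (3 * t) * (t * (48 * t * P) + t * (t * P)) + t * (t * (t * (t * P)))) := by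
        have hP0 : 0 < P := hP1
        have q1 : 2 * t + 1 ≤ 3 * t := by omega
        have q2 : 16 * (2 * t + 1) ≤ 48 * t := by omega
        have q3 : 1 ≤ t * (t * P) := Nat.mul_pos ht1 (Nat.mul_pos ht1 hP0)
        have q4 : t ≤ t * (t * (t * (t * P))) :=
          Nat.le_mul_of_pos_right _ (Nat.mul_pos ht1 q3)
        exact Nat.mul_le_mul_left _ (Nat.add_le_add (Nat.mul_le_mul (Nat.mul_le_mul_left _ q1)
          (Nat.add_le_add (Nat.mul_le_mul_left _ (Nat.mul_le_mul q2 hpow)) q3)) q4)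
      _ = 589 * (t ^ 5 * P) := by ring
      _ ≤ 144 ^ 5 * (t ^ 5 * P) := Nat.mul_le_mul_right _ (by norm_num)
      _ = _ := by ring
  have h2 : n ≤ (720 * k ^ 2) ^ (265 * k ^ 2) := by
    calc n ≤ (144 * t) ^ 5 * P := h1
      _ = (144 * t) ^ (5 + 48 * t) := by rw [hP, ← pow_add]
      _ ≤ (720 * k ^ 2) ^ (5 + 48 * t) := Nat.pow_le_pow_left (by omega) _
      _ ≤ _ := Nat.pow_le_pow_right (by nlinarith) (by nlinarith)
  have hk' : (1 : ℝ) ≤ k := by exact_mod_cast hk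
  have h3 : Real.log n ≤ Real.log ((720 * (k : ℝ) ^ 2) ^ (265 * k ^ 2)) := by
    apply Real.log_le_log
    · exact_mod_cast hn1
    · exact_mod_cast h2
  have h4 : Real.log (720 * (k : ℝ) ^ 2) ≤ 9 * k := by
    rw [Real.log_le_iff_le_exp (by positivity)]
    have e1 : Real.exp (9 * k) = Real.exp 7 * Real.exp (9 * k - 7) := by
      rw [← Real.exp_add]; ring_nf
    have e2 : (720 : ℝ) ≤ Real.exp 7 := by
      have : Real.exp 7 = Real.exp 1 ^ 7 := by rw [← Real.exp_nat_mul]; norm_num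
      rw [this]
      have h := Real.exp_one_gt_d9
      calc (720 : ℝ) ≤ 2.7 ^ 7 := by norm_num
        _ ≤ _ := by gcongr; linarith
    have e3 : (k : ℝ) ^ 2 ≤ Real.exp (9 * k - 7) := by
      have h := Real.add_one_le_exp ((k : ℝ) - 1)
      have h' : (k : ℝ) ^ 2 ≤ Real.exp ((k : ℝ) - 1) ^ 2 := by
        gcongr; linarith
      rw [← Real.exp_nat_mul] at h'
      refine h'.trans (Real.exp_le_exp.2 ?_)
      push_cast
      linarith
    rw [e1]
    gcongr
  rw [Real.log_pow] at h3
  push_cast at h3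
  calc Real.log n ≤ 265 * (k : ℝ) ^ 2 * Real.log (720 * (k : ℝ) ^ 2) := h3
    _ ≤ 265 * (k : ℝ) ^ 2 * (9 * k) := by gcongr
    _ = _ := by ring

end Core

theorem stmt_3 :
    ∃ c : ℝ, 0 < c ∧
      ∀ (n d : ℕ), d < n → 2 ≤ d →
        ∀ (V : Type) [Fintype V] [DecidableEq V] (G : SimpleGraph V) [DecidableRel G.Adj],
          Fintype.card V = n → G.Connected → G.IsRegularOfDegree d → IsVertexTransitive G →
          ∀ {x y : V} (X : G.Walk x x) (Y : G.Walk y y),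
            IsLongestCycle G X → IsLongestCycle G Y →
            c * (Real.log n / Real.log d) ^ ((1 : ℝ) / 3) ≤
              ((X.support.toFinset ∩ Y.support.toFinset).card : ℝ) := by
  refine ⟨1 / 16, by norm_num, ?_⟩
  intro n d hdn hd V _ _ G _ hcard hG _ hv x y X Y hX hY
  set k := (X.support.toFinset ∩ Y.support.toFinset).card with hk
  have hk1 : 1 ≤ k := by
    obtain ⟨z, h1, h2⟩ := meet hG hv hX hY
    exact Finset.card_pos.2 ⟨z, by simp [h1, h2]⟩
  have hb := core_bound hG hv hX hY k _ hk.symm rfl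
  rw [hcard] at hb
  have hlog := numer k _ n hk1 rfl hb (by omega)
  have hd2 : (2 : ℝ) ≤ d := by exact_mod_cast hd
  have hld : Real.log 2 ≤ Real.log d := Real.log_le_log (by norm_num) hd2
  have hl2 := Real.log_two_gt_d9
  have hdpos : 0 < Real.log d := by linarith
  have hn0 : 0 ≤ Real.log n := Real.log_natCast_nonneg n
  have hq : Real.log n / Real.log d ≤ (16 * (k : ℝ)) ^ 3 := by
    rw [div_le_iff₀ hdpos]
    have hk3 : (0 : ℝ) ≤ (k : ℝ) ^ 3 := by positivity
    nlinarith
  have hfin : (Real.log n / Real.log d) ^ ((1 : ℝ) / 3) ≤ 16 * (k : ℝ) := by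
    calc _ ≤ ((16 * (k : ℝ)) ^ 3) ^ ((1 : ℝ) / 3) :=
          Real.rpow_le_rpow (by positivity) hq (by norm_num)
      _ = 16 * (k : ℝ) := by
        rw [← Real.rpow_natCast, ← Real.rpow_mul (by positivity)]
        norm_num
  linarith
end

section
/- Let G be a 2-connected finite simple graph (so G has at least 3 vertices) and let X and Y be longest cycles of G. Then V(X) ∩ V(Y) ≠ ∅. -/
open SimpleGraph

/-- `G` is `k`-connected: it has more than `k` vertices and remains connected after
deleting any set of fewer than `k` vertices. -/
def IsKConnected {V : Type*} [Fintype V] (G : SimpleGraph V) (k : ℕ) : Prop :=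
  k < Fintype.card V ∧
    ∀ S : Finset V, S.card < k → ((⊤ : G.Subgraph).deleteVerts ↑S).coe.Connected

lemma aux_trim {V : Type*} {G : SimpleGraph V} (B : Set V) {a b : V} (p : G.Walk a b) (hb : b ∈ B) :
    ∃ c ∈ B, ∃ q : G.Walk a c, (∀ v ∈ q.support, v ∈ p.support) ∧
      (∀ v ∈ q.support, v ∈ B → v = c) := by
  induction p with
  | nil => exact ⟨_, hb, .nil, by simp, by simp⟩
  | @cons u v w h p ih =>
    by_cases hu : u ∈ B
    · exact ⟨u, hu, .nil, by simp, by simp⟩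
    · obtain ⟨c, hc, q, h1, h2⟩ := ih hb
      refine ⟨c, hc, .cons h q, ?_, ?_⟩
      · intro z hz
        simp only [Walk.support_cons, List.mem_cons] at hz ⊢
        exact hz.imp id (h1 z)
      · intro z hz hzB
        simp only [Walk.support_cons, List.mem_cons] at hz
        rcases hz with rfl | hz
        · exact absurd hzB hu
        · exact h2 z hz hzB

lemma aux_path_split {V : Type*} [DecidableEq V] {G : SimpleGraph V} {a b x v : V}
    {p : G.Walk a b} (hp : p.IsPath) (hx : x ∈ p.support)
    (h1 : v ∈ (p.takeUntil x hx).support) (h2 : v ∈ (p.dropUntil x hx).support) : v = x := by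
  by_contra hne
  have hp' : ((p.takeUntil x hx).append (p.dropUntil x hx)).IsPath := by
    rw [Walk.take_spec]; exact hp
  exact hp'.ne_of_mem_support_of_append hne h1 h2 rfl

lemma aux_start_notMem {V : Type*} [DecidableEq V] {G : SimpleGraph V} {a b y : V}
    {p : G.Walk a b} (hp : p.IsPath) (hy : y ∈ p.support) (hne : a ≠ y) :
    a ∉ (p.dropUntil y hy).support := fun h =>
  hne (aux_path_split hp hy (Walk.start_mem_support _) h)

lemma aux_menger {V : Type*} [DecidableEq V] {G : SimpleGraph V} (A : Set V) (n : ℕ) :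
    ∀ (B : Set V) (a b : V) (P : G.Walk a b), P.length ≤ n → P.IsPath → a ∈ A → b ∈ B →
      (∀ v ∈ P.support, v ∈ B → v = b) →
      (∀ s, ∃ a ∈ A, ∃ b ∈ B, ∃ p : G.Walk a b, s ∉ p.support) →
      ∃ a₁ ∈ A, ∃ a₂ ∈ A, ∃ b₂ ∈ B, ∃ (p : G.Walk a₁ b) (q : G.Walk a₂ b₂),
        (∀ v ∈ p.support, v ∉ q.support) ∧ (∀ v ∈ p.support, v ∈ B → v = b) ∧
        (∀ v ∈ q.support, v ∈ B → v = b₂) := by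
  induction n using Nat.strong_induction_on with
  | _ n ih =>
  intro B a b P hn hP ha hb hPB hsep
  obtain ⟨a', ha', b₀, hb₀, R₀, hR₀⟩ := hsep b
  obtain ⟨b', hb', R, hRR, hRB⟩ := aux_trim B R₀ hb₀
  have hbR : b ∉ R.support := fun h => hR₀ (hRR _ h)
  by_cases hdis : ∀ v ∈ P.support, v ∉ R.support
  · exact ⟨a, ha, a', ha', b', hb', P, R, hdis, hPB, hRB⟩
  push Not at hdis
  obtain ⟨z, hzP, hzR⟩ := hdis
  obtain ⟨x, hxP, T', hT', hTP'⟩ := aux_trim {v | v ∈ P.support} (R.dropUntil z hzR).reverse hzP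
  -- T : path from x to b'
  obtain ⟨T, hTpath, hTR, hTP⟩ : ∃ T : G.Walk x b', T.IsPath ∧ (∀ v ∈ T.support, v ∈ R.support) ∧
      (∀ v ∈ T.support, v ∈ P.support → v = x) := by
    have hs : ∀ v ∈ (T'.reverse.toPath : G.Walk x b').support, v ∈ T'.support := by
      intro v hv
      have := Walk.support_toPath_subset_support _ hv
      simpa using this
    refine ⟨T'.reverse.toPath, Path.isPath _, ?_, ?_⟩
    · intro v hv
      have := hT' v (hs v hv)
      rw [Walk.support_reverse, List.mem_reverse] at this
      exact Walk.support_dropUntil_subset_support _ hzR this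
    · intro v hv hvP
      exact hTP' v (hs v hv) hvP
  have hxP : x ∈ P.support := hxP
  have hxR : x ∈ R.support := hTR _ (Walk.start_mem_support _)
  have hxb : x ≠ b := fun h => hbR (h ▸ hxR)
  set D := P.dropUntil x hxP with hD
  have hDP : ∀ v ∈ D.support, v ∈ P.support := fun v hv =>
    Walk.support_dropUntil_subset_support _ hxP hv
  have hDpath : D.IsPath := hP.dropUntil hxP
  have hlt := P.length_takeUntil_lt_length hxP hxb
  obtain ⟨a₁, ha₁, a₂, ha₂, y, hy, p, q, hpq, hpB, hqB⟩ :=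
    ih (P.takeUntil x hxP).length (by omega)
      (B ∪ {v | v ∈ D.support} ∪ {v | v ∈ T.support}) a x (P.takeUntil x hxP) le_rfl
      (hP.takeUntil hxP) ha (Or.inr (Walk.start_mem_support _)) (by
        intro v hv hvB
        have hvP := Walk.support_takeUntil_subset_support _ hxP hv
        rcases hvB with (hvB | hvD) | hvT
        · have := hPB v hvP hvB
          subst this
          exact aux_path_split hP hxP hv (Walk.end_mem_support _)
        · exact aux_path_split hP hxP hv hvD
        · exact hTP v hvT hvP) (by
        intro s
        obtain ⟨a, ha, b, hb, p, hp⟩ := hsep s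
        exact ⟨a, ha, b, Or.inl (Or.inl hb), p, hp⟩)
  have hxy : x ≠ y := fun h => hpq x (Walk.end_mem_support _) (by rw [h]; exact Walk.end_mem_support _)
  have hxB : x ∉ B := fun h => hxb (hPB x hxP h)
  have hpB1 : ∀ v ∈ p.support, v ∉ B := fun v hv hvB =>
    hxB (hpB v hv (Or.inl (Or.inl hvB)) ▸ hvB)
  have hDB : ∀ v ∈ D.support, v ∈ B → v = b := fun v hv => hPB v (hDP v hv)
  have hTB : ∀ v ∈ T.support, v ∈ B → v = b' := fun v hv => hRB v (hTR v hv)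
  have hpD : ∀ v ∈ p.support, v ∈ D.support → v = x := fun v hv hvD =>
    hpB v hv (Or.inl (Or.inr hvD))
  have hpT : ∀ v ∈ p.support, v ∈ T.support → v = x := fun v hv hvT =>
    hpB v hv (Or.inr hvT)
  have hqD : ∀ v ∈ q.support, v ∈ D.support → v = y := fun v hv hvD =>
    hqB v hv (Or.inl (Or.inr hvD))
  have hqT : ∀ v ∈ q.support, v ∈ T.support → v = y := fun v hv hvT =>
    hqB v hv (Or.inr hvT)
  have hqB1 : ∀ v ∈ q.support, v ∈ B → v = y := fun v hv hvB =>
    hqB v hv (Or.inl (Or.inl hvB))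
  have hDT : ∀ v ∈ D.support, v ∈ T.support → v = x := fun v hv hvT => hTP v hvT (hDP v hv)
  by_cases hyD : y ∈ D.support
  · have hyT : y ∉ T.support := fun h => hxy (hDT y hyD h).symm
    have hxE := aux_start_notMem hDpath hyD hxy
    have hE : ∀ v ∈ (D.dropUntil y hyD).support, v ∈ D.support := fun v hv =>
      Walk.support_dropUntil_subset_support _ hyD hv
    refine ⟨a₂, ha₂, a₁, ha₁, b', hb', q.append (D.dropUntil y hyD), p.append T, ?_, ?_, ?_⟩
    · intro v hv hv'
      rw [Walk.mem_support_append_iff] at hv hv'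
      grind
    · intro v hv
      rw [Walk.mem_support_append_iff] at hv
      grind
    · intro v hv
      rw [Walk.mem_support_append_iff] at hv
      grind
  by_cases hyT : y ∈ T.support
  · have hxE := aux_start_notMem hTpath hyT hxy
    have hE : ∀ v ∈ (T.dropUntil y hyT).support, v ∈ T.support := fun v hv =>
      Walk.support_dropUntil_subset_support _ hyT hv
    refine ⟨a₁, ha₁, a₂, ha₂, b', hb', p.append D, q.append (T.dropUntil y hyT), ?_, ?_, ?_⟩
    · intro v hv hv'
      rw [Walk.mem_support_append_iff] at hv hv'
      grind
    · intro v hv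
      rw [Walk.mem_support_append_iff] at hv
      grind
    · intro v hv
      rw [Walk.mem_support_append_iff] at hv
      grind
  · have hyB : y ∈ B := by
      rcases hy with (h | h) | h
      · exact h
      · exact absurd h hyD
      · exact absurd h hyT
    refine ⟨a₁, ha₁, a₂, ha₂, y, hyB, p.append D, q, ?_, ?_, hqB1⟩
    · intro v hv hv'
      rw [Walk.mem_support_append_iff] at hv
      grind
    · intro v hv
      rw [Walk.mem_support_append_iff] at hv
      grind

lemma aux_append_path {V : Type*} {G : SimpleGraph V} {u v w : V} {p : G.Walk u v}
    {q : G.Walk v w} (hp : p.IsPath) (hq : q.IsPath)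
    (h : ∀ z ∈ p.support, z ∈ q.support → z = v) : (p.append q).IsPath := by
  rw [Walk.isPath_def, Walk.support_append, List.nodup_append']
  refine ⟨hp.support_nodup, hq.support_nodup.tail, ?_⟩
  intro z hz hz'
  have := h z hz (List.mem_of_mem_tail hz')
  subst this
  have h2 := hq.support_nodup
  rw [← Walk.cons_tail_support, List.nodup_cons] at h2
  exact h2.1 hz'

lemma aux_close {V : Type*} {G : SimpleGraph V} {u v : V} {p : G.Walk u v}
    {q : G.Walk v u} (hp : p.IsPath) (hq : q.IsPath) (hl : 1 < p.length)
    (h : ∀ z ∈ p.support, z ∈ q.support → z = u ∨ z = v) : (p.append q).IsCycle := by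
  refine hp.isCycle_append hq ?_ (Or.inl hl)
  intro z hz hz'
  have h1 := hp.support_nodup
  rw [← Walk.cons_tail_support, List.nodup_cons] at h1
  have h2 := hq.support_nodup
  rw [← Walk.cons_tail_support, List.nodup_cons] at h2
  rcases h z (List.mem_of_mem_tail hz) (List.mem_of_mem_tail hz') with rfl | rfl
  · exact h1.1 hz
  · exact h2.1 hz'

lemma aux_arc {V : Type*} [DecidableEq V] {G : SimpleGraph V} {x u v : V} (X : G.Walk x x)
    (hX : X.IsCycle) (hu : u ∈ X.support) (hv : v ∈ X.support) (huv : u ≠ v) :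
    ∃ p : G.Walk u v, p.IsPath ∧ (∀ z ∈ p.support, z ∈ X.support) ∧ X.length ≤ 2 * p.length := by
  have hC : (X.rotate u hu).IsCycle := hX.rotate hu
  have hs : ∀ z, z ∈ (X.rotate u hu).support ↔ z ∈ X.support := by
    intro z
    simp
  have hl : (X.rotate u hu).length = X.length := by simp
  generalize X.rotate u hu = C at hC hs hl
  have hvC : v ∈ C.support := (hs v).2 hv
  have e := C.take_spec hvC
  have el : (C.takeUntil v hvC).length + (C.dropUntil v hvC).length = C.length := by
    rw [← Walk.length_append, e]
  by_cases hle : C.length ≤ 2 * (C.takeUntil v hvC).length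
  · exact ⟨C.takeUntil v hvC, hC.isPath_takeUntil hvC, fun z hz =>
      (hs z).1 (Walk.support_takeUntil_subset_support _ hvC hz), by omega⟩
  · refine ⟨(C.dropUntil v hvC).reverse, ?_, ?_, ?_⟩
    · refine Walk.IsPath.reverse (Walk.IsCycle.isPath_of_append_right (p := C.takeUntil v hvC) 
        (Walk.not_nil_of_ne huv) ?_)
      rw [e]; exact hC
    · intro z hz
      rw [Walk.support_reverse, List.mem_reverse] at hz
      exact (hs z).1 (Walk.support_dropUntil_subset_support _ hvC hz)
    · rw [Walk.length_reverse]; omega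

lemma aux_ne {V : Type*} {G : SimpleGraph V} {x : V} (X : G.Walk x x)
    (hX : X.IsCycle) (s : V) : ∃ a ∈ X.support, a ≠ s := by
  by_cases h : x = s
  · subst h
    exact ⟨X.snd, X.getVert_mem_support 1, (X.adj_snd hX.not_nil).ne'⟩
  · exact ⟨x, Walk.start_mem_support _, h⟩

/-- clean up a walk so that it is a path meeting `A` only at its start. -/
lemma aux_clean {V : Type*} [DecidableEq V] {G : SimpleGraph V} (A : Set V) {a b : V}
    (p : G.Walk a b) (ha : a ∈ A) : ∃ c ∈ A, ∃ q : G.Walk c b, q.IsPath ∧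
      (∀ v ∈ q.support, v ∈ p.support) ∧ (∀ v ∈ q.support, v ∈ A → v = c) := by
  obtain ⟨c, hc, q, h1, h2⟩ := aux_trim A p.reverse ha
  have hs : ∀ v ∈ (q.reverse.toPath : G.Walk c b).support, v ∈ q.support := by
    intro v hv
    have := Walk.support_toPath_subset_support _ hv
    simpa using this
  refine ⟨c, hc, q.reverse.toPath, Path.isPath _, ?_, fun v hv => h2 v (hs v hv)⟩
  intro v hv
  simpa using h1 v (hs v hv)

theorem stmt_5 {V : Type*} [Fintype V] [DecidableEq V] (G : SimpleGraph V)
    (h2 : IsKConnected G 2) {x y : V} (X : G.Walk x x) (Y : G.Walk y y)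
    (hX : IsLongestCycle G X) (hY : IsLongestCycle G Y) :
    ∃ v : V, v ∈ X.support ∧ v ∈ Y.support := by
  by_contra hcon
  push Not at hcon
  have hsep : ∀ s, ∃ a ∈ {v | v ∈ X.support}, ∃ b ∈ {v | v ∈ Y.support},
      ∃ p : G.Walk a b, s ∉ p.support := by
    intro s
    obtain ⟨a, ha, has⟩ := aux_ne X hX.1 s
    obtain ⟨b, hb, hbs⟩ := aux_ne Y hY.1 s
    refine ⟨a, ha, b, hb, ?_⟩
    have hc := h2.2 {s} (by simp)
    obtain ⟨w⟩ := hc.preconnected ⟨a, by simpa using has⟩ ⟨b, by simpa using hbs⟩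
    refine ⟨w.map (Subgraph.hom _), ?_⟩
    intro hs
    have e := Walk.support_map (Subgraph.hom _) w
    have hs' := e ▸ hs
    obtain ⟨z, -, hz⟩ := List.mem_map.1 hs'
    have := z.2
    simp at this hz
    exact this hz
  obtain ⟨a₀, ha₀, b₀, hb₀, p₀, -⟩ := hsep x
  obtain ⟨b, hb, P, -, hPB⟩ := aux_trim _ p₀ hb₀
  obtain ⟨a₁, ha₁, a₂, ha₂, b₂, hb₂, p', q', hpq', hpB', hqB'⟩ :=
    aux_menger {v | v ∈ X.support} _ {v | v ∈ Y.support} a₀ b P.toPath le_rfl (Path.isPath _)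
      ha₀ hb (fun v hv => hPB v (Walk.support_toPath_subset_support _ hv)) hsep
  obtain ⟨c, hc, p, hp, hpp, hpA⟩ := aux_clean _ p' ha₁
  obtain ⟨d, hd, q, hq, hqq, hqA⟩ := aux_clean _ q' ha₂
  have hpB : ∀ v ∈ p.support, v ∈ Y.support → v = b := fun v hv => hpB' v (hpp v hv)
  have hqB : ∀ v ∈ q.support, v ∈ Y.support → v = b₂ := fun v hv => hqB' v (hqq v hv)
  have hpq : ∀ v ∈ p.support, v ∉ q.support := fun v hv hv' => hpq' v (hpp v hv) (hqq v hv')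
  simp only [Set.mem_ofPred_eq] at hpA hqA hc hd hb hb₂
  clear hpB' hqB' hpq' hpp hqq
  have hcd : c ≠ d := fun h =>
    hpq c (Walk.start_mem_support _) (by rw [h]; exact Walk.start_mem_support _)
  have hbb : b₂ ≠ b := fun h =>
    hpq b (Walk.end_mem_support _) (h ▸ Walk.end_mem_support _)
  have hcb : c ≠ b := fun h => hcon c hc (h ▸ hb)
  have hdb : d ≠ b₂ := fun h => hcon d hd (h ▸ hb₂)
  obtain ⟨S, hS, hSX, hSl⟩ := aux_arc X hX.1 hc hd hcd
  obtain ⟨T, hT, hTY, hTl⟩ := aux_arc Y hY.1 hb₂ hb hbb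
  have h1 : (S.append q).IsPath := aux_append_path hS hq
    (fun z hz hz' => hqA z hz' (hSX z hz))
  have h3 : ((S.append q).append T).IsPath := by
    refine aux_append_path h1 hT ?_
    intro z hz hz'
    rw [Walk.mem_support_append_iff] at hz
    rcases hz with hz | hz
    · exact absurd (hTY z hz') (hcon z (hSX z hz))
    · exact hqB z hz (hTY z hz')
  have hpl : 0 < p.length := by
    by_contra h
    exact hcb (Walk.eq_of_length_eq_zero (by omega : p.length = 0))
  have hql : 0 < q.length := by
    by_contra h
    exact hdb (Walk.eq_of_length_eq_zero (by omega : q.length = 0))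
  have h3X := hX.1.three_le_length
  have hXY := hX.2 _ Y hY.1
  have hYX := hY.2 _ X hX.1
  have hcyc : (((S.append q).append T).append p.reverse).IsCycle := by
    refine aux_close h3 hp.reverse ?_ ?_
    · simp only [Walk.length_append]; omega
    · intro z hz hz'
      rw [Walk.support_reverse, List.mem_reverse] at hz'
      rw [Walk.mem_support_append_iff, Walk.mem_support_append_iff] at hz
      rcases hz with (hz | hz) | hz
      · exact Or.inl (hpA z hz' (hSX z hz))
      · exact absurd hz (hpq z hz')
      · exact Or.inr (hpB z hz' (hTY z hz))
  have := hX.2 _ _ hcyc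
  simp only [Walk.length_append, Walk.length_reverse] at this
  omega
end
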